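/- arXiv:2001.04132 — 12 statements merged into one kernel-verified Lean document; each statement's English description precedes it below -/
import Mathlib

section
/- For all integers r and t with 1 ≤ t ≤ r, there exists an (r,t)-graph H whose cover number satisfies τ(H) ≥ ⌊(r−t)/2⌋ + 1. -/
/-- `E` is the edge set of an `r`-uniform `r`-partite hypergraph on vertex type `V`
with parts given by the fibres of `part`: each edge contains exactly one vertex
from each of the `r` parts. -/
def IsRPartite {V : Type} (r : ℕ) (part : V → Fin r) (E : Finset (Finset V)) : Prop :=
  ∀ e ∈ E, ∀ j : Fin r, (e.filter (fun v => part v = j)).card = 1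

/-- The hypergraph with edge set `E` is `t`-intersecting. -/
def IntersectingGe {V : Type} (t : ℕ) (E : Finset (Finset V)) : Prop :=
  ∀ e ∈ E, ∀ f ∈ E, t ≤ ((↑e ∩ ↑f : Set V)).ncard

/-- `C` is a vertex cover of the hypergraph with edge set `E`. -/
def IsCover {V : Type} (E : Finset (Finset V)) (C : Finset V) : Prop :=
  ∀ e ∈ E, ∃ v ∈ e, v ∈ C

/-- The cover number: the minimum size of a vertex cover. -/
noncomputable def coverNumber {V : Type} (E : Finset (Finset V)) : ℕ :=
  sInf {n | ∃ C : Finset V, IsCover E C ∧ C.card = n}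

/-- The transversal of the parts of `Fin r × Option (Fin m)` that takes the vertex `some i` in the
parts indexed by `S` and the vertex `none` in all others. -/
def deviatingEdge {r m : ℕ} (S : Finset (Fin r)) (i : Fin m) :
    Finset (Fin r × Option (Fin m)) :=
  Finset.univ.image fun j => (j, if j ∈ S then some i else none)

/-- The hypergraph of all `deviatingEdge`s that avoid `none` in at most `k` parts, with `k + 1`
values available for deviating. -/
def deviatingEdges (r k : ℕ) : Finset (Finset (Fin r × Option (Fin (k + 1)))) :=
  ((Finset.univ.filter fun S : Finset (Fin r) => S.card ≤ k) ×ˢ Finset.univ).image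
    fun p => deviatingEdge p.1 p.2

lemma mem_deviatingEdge {r m : ℕ} {S : Finset (Fin r)} {i : Fin m}
    {v : Fin r × Option (Fin m)} :
    v ∈ deviatingEdge S i ↔ v.2 = if v.1 ∈ S then some i else none := by
  obtain ⟨a, b⟩ := v
  simp [deviatingEdge, eq_comm]

lemma mem_deviatingEdges {r k : ℕ} {e : Finset (Fin r × Option (Fin (k + 1)))} :
    e ∈ deviatingEdges r k ↔ ∃ S i, S.card ≤ k ∧ deviatingEdge S i = e := by
  simp [deviatingEdges]

lemma isRPartite_deviatingEdges (r k : ℕ) :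
    IsRPartite r Prod.fst (deviatingEdges r k) := by
  intro e he j
  obtain ⟨S, i, -, rfl⟩ := mem_deviatingEdges.1 he
  refine Finset.card_eq_one.2 ⟨(j, if j ∈ S then some i else none), ?_⟩
  ext ⟨a, b⟩
  simp only [Finset.mem_filter, mem_deviatingEdge, Finset.mem_singleton, Prod.mk.injEq]
  exact ⟨fun ⟨hb, ha⟩ => ⟨ha, ha ▸ hb⟩, fun ⟨ha, hb⟩ => ⟨ha ▸ hb, ha⟩⟩

lemma intersectingGe_deviatingEdges (r k : ℕ) :
    IntersectingGe (r - 2 * k) (deviatingEdges r k) := by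
  intro e he f hf
  obtain ⟨S, i, hS, rfl⟩ := mem_deviatingEdges.1 he
  obtain ⟨T, l, hT, rfl⟩ := mem_deviatingEdges.1 hf
  have hsub : (S ∪ T)ᶜ.image (fun j => (j, (none : Option (Fin (k + 1))))) ⊆
      deviatingEdge S i ∩ deviatingEdge T l := by
    intro v hv
    obtain ⟨j, hj, rfl⟩ := Finset.mem_image.1 hv
    simp only [Finset.mem_compl, Finset.mem_union, not_or] at hj
    simp [mem_deviatingEdge, hj.1, hj.2]
  have hcard := Finset.card_le_card hsub
  rw [Finset.card_image_of_injective _ fun a b h => (Prod.mk.inj h).1, Finset.card_compl,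
    Fintype.card_fin] at hcard
  rw [← Finset.coe_inter, Set.ncard_coe_finset]
  have hunion := Finset.card_union_le S T
  omega

lemma lt_card_of_isCover_deviatingEdges {r k : ℕ} {C : Finset (Fin r × Option (Fin (k + 1)))}
    (hC : IsCover (deviatingEdges r k) C) : k < C.card := by
  by_contra! hk
  obtain ⟨i, hi⟩ : ∃ i : Fin (k + 1), some i ∉ C.image Prod.snd := by
    by_contra! h
    have hsub : (Finset.univ.image (some : Fin (k + 1) → _)) ⊆ C.image Prod.snd := by
      intro x hx
      obtain ⟨i, -, rfl⟩ := Finset.mem_image.1 hx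
      exact h i
    have hcard := (Finset.card_le_card hsub).trans Finset.card_image_le
    rw [Finset.card_image_of_injective _ (Option.some_injective _), Finset.card_univ,
      Fintype.card_fin] at hcard
    omega
  obtain ⟨⟨j, x⟩, hve, hvC⟩ := hC _ (mem_deviatingEdges.2
    ⟨C.image Prod.fst, i, Finset.card_image_le.trans hk, rfl⟩)
  have hj : j ∈ C.image Prod.fst := Finset.mem_image_of_mem Prod.fst hvC
  simp only [mem_deviatingEdge, if_pos hj] at hve
  exact hi (hve ▸ Finset.mem_image_of_mem Prod.snd hvC)

lemma lt_coverNumber_deviatingEdges {r : ℕ} (hr : 0 < r) (k : ℕ) :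
    k < coverNumber (deviatingEdges r k) := by
  have hcover : IsCover (deviatingEdges r k) Finset.univ := by
    intro e he
    obtain ⟨S, i, -, rfl⟩ := mem_deviatingEdges.1 he
    exact ⟨_, Finset.mem_image_of_mem _ (Finset.mem_univ (⟨0, hr⟩ : Fin r)), Finset.mem_univ _⟩
  rw [coverNumber, ← Nat.succ_le_iff]
  refine le_csInf ⟨_, Finset.univ, hcover, rfl⟩ ?_
  rintro n ⟨C, hC, rfl⟩
  exact lt_card_of_isCover_deviatingEdges hC

/-- **Theorem 1.2** (lower bound): for all `1 ≤ t ≤ r` there is an `(r,t)`-graph `H`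
with `τ(H) ≥ ⌊(r - t)/2⌋ + 1`. -/
theorem exists_rt_graph_large_cover (r t : ℕ) (ht : 1 ≤ t) (htr : t ≤ r) :
    ∃ (V : Type) (_ : Fintype V) (part : V → Fin r) (E : Finset (Finset V)),
      IsRPartite r part E ∧ IntersectingGe t E ∧
      (r - t) / 2 + 1 ≤ coverNumber E := by
  refine ⟨Fin r × Option (Fin ((r - t) / 2 + 1)), inferInstance, Prod.fst,
    deviatingEdges r ((r - t) / 2), isRPartite_deviatingEdges _ _, fun e he f hf => ?_,
    lt_coverNumber_deviatingEdges (by omega) _⟩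
  exact le_trans (by omega) (intersectingGe_deviatingEdges r ((r - t) / 2) e he f hf)
end

section
/- For all integers r and t with 1 ≤ t ≤ r ≤ 3t − 1, every (r,t)-graph H satisfies τ(H) ≤ ⌊(r−t)/2⌋ + 1. -/
/-- Two vertices of an edge that lie in the same part coincide. -/
theorem IsRPartite.eq_of_part_eq {V : Type} {r : ℕ} {part : V → Fin r} {E : Finset (Finset V)}
    (hP : IsRPartite r part E) {e : Finset V} (he : e ∈ E) {x y : V} (hx : x ∈ e) (hy : y ∈ e)
    (hxy : part x = part y) : x = y :=
  Finset.card_le_one.mp (hP e he (part y)).le x (Finset.mem_filter.mpr ⟨hx, hxy⟩) y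
    (Finset.mem_filter.mpr ⟨hy, rfl⟩)

/-- The vertices lying in at least two of three edges belong to pairwise distinct parts. -/
theorem IsRPartite.card_majority_le {V : Type} [DecidableEq V] {r : ℕ} {part : V → Fin r}
    {E : Finset (Finset V)} (hP : IsRPartite r part E) {e f g : Finset V}
    (he : e ∈ E) (hf : f ∈ E) (hg : g ∈ E) :
    (e ∩ f ∪ e ∩ g ∪ f ∩ g).card ≤ r := by
  have hinj : Set.InjOn part (e ∩ f ∪ e ∩ g ∪ f ∩ g : Finset V) := by
    intro x hx y hy hxy
    have h1 := fun hx hy => hP.eq_of_part_eq he (x := x) (y := y) hx hy hxy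
    have h2 := fun hx hy => hP.eq_of_part_eq hf (x := x) (y := y) hx hy hxy
    have h3 := fun hx hy => hP.eq_of_part_eq hg (x := x) (y := y) hx hy hxy
    simp only [Finset.mem_coe, Finset.mem_union, Finset.mem_inter] at hx hy
    tauto
  simpa using Finset.card_le_card_of_injOn (t := Finset.univ) part (by simp) hinj

/-- Inclusion-exclusion for the vertices lying in at least two of three edges. -/
theorem IsRPartite.card_inter_add_le {V : Type} [DecidableEq V] {r : ℕ} {part : V → Fin r}
    {E : Finset (Finset V)} (hP : IsRPartite r part E) {e f g : Finset V}
    (he : e ∈ E) (hf : f ∈ E) (hg : g ∈ E) :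
    (e ∩ f).card + (e ∩ g).card + (f ∩ g).card ≤ r + 2 * (e ∩ f ∩ g).card := by
  have h := hP.card_majority_le he hf hg
  have h1 := Finset.card_union_add_card_inter (e ∩ f) (e ∩ g)
  have h2 := Finset.card_union_add_card_inter (e ∩ f ∪ e ∩ g) (f ∩ g)
  have h3 : e ∩ f ∩ (e ∩ g) = e ∩ f ∩ g := by grind
  have h4 : (e ∩ f ∪ e ∩ g) ∩ (f ∩ g) = e ∩ f ∩ g := by grind
  rw [h3] at h1
  rw [h4] at h2
  omega

theorem coverNumber_le_card {V : Type} {E : Finset (Finset V)} {C : Finset V}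
    (hC : IsCover E C) : coverNumber E ≤ C.card :=
  Nat.sInf_le ⟨C, hC, rfl⟩

/-- **Theorem 1.3 / first case of Theorem 1.4**: for `1 ≤ t ≤ r ≤ 3t - 1`, every
`(r,t)`-graph `H` satisfies `τ(H) ≤ ⌊(r - t)/2⌋ + 1`. -/
theorem cover_le_of_r_le_three_t_sub_one {V : Type} [Fintype V] (r t : ℕ)
    (ht : 1 ≤ t) (htr : t ≤ r) (hr : r ≤ 3 * t - 1)
    (part : V → Fin r) (E : Finset (Finset V))
    (hP : IsRPartite r part E) (hI : IntersectingGe t E) :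
    coverNumber E ≤ (r - t) / 2 + 1 := by
  classical
  have hI' : ∀ e ∈ E, ∀ f ∈ E, t ≤ (e ∩ f).card := fun e he f hf => by
    simpa only [← Finset.coe_inter, Set.ncard_coe_finset] using hI e he f hf
  rcases E.eq_empty_or_nonempty with rfl | hE
  · exact (coverNumber_le_card (C := ∅) (by simp [IsCover])).trans (by simp)
  obtain ⟨⟨e, f⟩, hef, hmin⟩ :=
    Finset.exists_min_image (E ×ˢ E) (fun p => (p.1 ∩ p.2).card) (hE.product hE)
  obtain ⟨he, hf⟩ : e ∈ E ∧ f ∈ E := Finset.mem_product.mp hef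
  obtain ⟨B, hB, hBcard⟩ := Finset.exists_subset_card_eq (s := e ∩ f) (n := (r - t) / 2 + 1)
    (by have := hI' e he f hf; omega)
  rw [← hBcard]
  refine coverNumber_le_card fun g hg => ?_
  by_contra! hgB
  have hsub : e ∩ f ∩ g ⊆ (e ∩ f) \ B := fun v hv => by
    have hv' := Finset.mem_inter.mp hv
    exact Finset.mem_sdiff.mpr ⟨hv'.1, hgB v hv'.2⟩
  have hcard := Finset.card_le_card hsub
  rw [Finset.card_sdiff_of_subset hB] at hcard
  have hBle := Finset.card_le_card hB
  have heg : (e ∩ f).card ≤ (e ∩ g).card := hmin (e, g) (Finset.mk_mem_product he hg)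
  have hfg : (e ∩ f).card ≤ (f ∩ g).card := hmin (f, g) (Finset.mk_mem_product hf hg)
  have hmaj := hP.card_inter_add_le he hf hg
  have hef_ge := hI' e he f hf
  omega
end

section
/- For all integers r and t with 1 ≤ t and r ≥ 3t, every (r,t)-graph H satisfies τ(H) ≤ 2r − 5t + 2. -/
/-- Each part meets an edge of an `r`-partite hypergraph in at most one vertex. -/
theorem IsRPartite.injOn {V : Type} {r : ℕ} {part : V → Fin r} {E : Finset (Finset V)}
    (hP : IsRPartite r part E) {e : Finset V} (he : e ∈ E) : Set.InjOn part e := by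
  intro v hv w hw hvw
  have h := Finset.card_le_one.1 (hP e he (part w)).le
  exact h v (by simpa using ⟨hv, hvw⟩) w (by simpa using hw)

open Classical in
/-- Two edges `e`, `f` realising the minimum intersection size `k` yield a cover made of `c`
vertices of `e ∩ f` and the vertices of `e ∪ f` in `x` parts which `e ∩ f` avoids. -/
theorem coverNumber_le_of_card_inter_eq {V : Type} {r k c x : ℕ} {part : V → Fin r}
    {E : Finset (Finset V)} (hP : IsRPartite r part E)
    (hE : ∀ e ∈ E, ∀ f ∈ E, k ≤ (e ∩ f).card) {e f : Finset V} (he : e ∈ E) (hf : f ∈ E)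
    (hk : (e ∩ f).card = k) (hc : c ≤ k) (hx : x + k ≤ r) (hcx : r < 2 * c + x + k) :
    coverNumber E ≤ c + 2 * x := by
  set J : Finset (Fin r) := (e ∩ f).image part with hJ
  have hJcard : J.card = k := by
    rw [hJ, Finset.card_image_of_injOn, hk]
    exact (hP.injOn he).mono (by simp)
  obtain ⟨C, hCsub, hCcard⟩ := Finset.exists_subset_card_eq (hk ▸ hc : c ≤ (e ∩ f).card)
  obtain ⟨X, hXsub, hXcard⟩ : ∃ X ⊆ Jᶜ, X.card = x :=
    Finset.exists_subset_card_eq (by rw [Finset.card_compl, hJcard, Fintype.card_fin]; omega)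
  have card_filter_parts : ∀ g ∈ E, (g.filter fun v => part v ∈ X).card ≤ x := by
    intro g hg
    rw [← hXcard]
    refine Finset.card_le_card_of_injOn part (fun v hv => (Finset.mem_filter.1 hv).2) ?_
    exact (hP.injOn hg).mono fun v hv => (Finset.mem_filter.1 hv).1
  have hcover : IsCover E
      (C ∪ ((e.filter fun v => part v ∈ X) ∪ f.filter fun v => part v ∈ X)) := by
    intro g hg
    by_contra! hmiss
    have hinter : (g ∩ (e ∩ f)).card + c ≤ k := by
      rw [← hCcard, ← hk, ← Finset.card_union_of_disjoint]
      · exact Finset.card_le_card (Finset.union_subset Finset.inter_subset_right hCsub)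
      · rw [Finset.disjoint_left]
        intro v hv hvC
        exact hmiss v (Finset.mem_inter.1 hv).1 (Finset.mem_union_left _ hvC)
    have hdiff : ((g ∩ (e ∪ f)) \ (e ∩ f)).card ≤ ((J ∪ X)ᶜ).card := by
      refine Finset.card_le_card_of_injOn part ?_ ((hP.injOn hg).mono ?_)
      · intro v hv
        simp only [Finset.coe_sdiff, Set.mem_sdiff, Finset.mem_coe, Finset.mem_inter,
          Finset.mem_union] at hv
        obtain ⟨⟨hvg, hvef⟩, hvn⟩ := hv
        have hvm := hmiss v hvg
        simp only [Finset.mem_union, Finset.mem_filter] at hvm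
        simp only [hJ, Finset.coe_compl, Set.mem_compl_iff, Finset.mem_coe, Finset.mem_union,
          Finset.mem_image, Finset.mem_inter]
        rintro (⟨w, ⟨hwe, hwf⟩, hwv⟩ | hvX)
        · rcases hvef with hve | hvf
          · exact hvn (hP.injOn he hwe hve hwv ▸ ⟨hwe, hwf⟩)
          · exact hvn (hP.injOn hf hwf hvf hwv ▸ ⟨hwe, hwf⟩)
        · tauto
      · intro v hv
        simp only [Finset.coe_sdiff, Set.mem_sdiff, Finset.mem_coe, Finset.mem_inter] at hv
        exact hv.1.1
    have hJX : (J ∪ X).card = k + x := by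
      rw [Finset.card_union_of_disjoint, hJcard, hXcard]
      exact Finset.subset_compl_iff_disjoint_left.1 hXsub
    rw [Finset.card_compl, hJX, Fintype.card_fin] at hdiff
    have hsum := Finset.card_union_add_card_inter (g ∩ e) (g ∩ f)
    rw [← Finset.inter_union_distrib_left, ← Finset.inter_inter_distrib_left] at hsum
    have hsplit := Finset.card_sdiff_add_card_inter (g ∩ (e ∪ f)) (e ∩ f)
    have heq : g ∩ (e ∪ f) ∩ (e ∩ f) = g ∩ (e ∩ f) := by
      ext v
      simp only [Finset.mem_inter, Finset.mem_union]
      tauto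
    rw [heq] at hsplit
    have hge := hE g hg e he
    have hgf := hE g hg f hf
    omega
  refine (coverNumber_le_card hcover).trans ((Finset.card_union_le _ _).trans ?_)
  have hunion := Finset.card_union_le (e.filter fun v => part v ∈ X) (f.filter fun v => part v ∈ X)
  have hXe := card_filter_parts e he
  have hXf := card_filter_parts f hf
  omega

/-- **Second case of Theorem 1.4**: for `t ≥ 1` and `r ≥ 3t`, every `(r,t)`-graph `H`
satisfies `τ(H) ≤ 2r - 5t + 2`. -/
theorem cover_le_two_r_sub_five_t {V : Type} [Fintype V] (r t : ℕ)
    (ht : 1 ≤ t) (hr : 3 * t ≤ r)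
    (part : V → Fin r) (E : Finset (Finset V))
    (hP : IsRPartite r part E) (hI : IntersectingGe t E) :
    (coverNumber E : ℤ) ≤ 2 * (r : ℤ) - 5 * (t : ℤ) + 2 := by
  classical
  rcases E.eq_empty_or_nonempty with rfl | hne
  · have h : coverNumber (∅ : Finset (Finset V)) ≤ (∅ : Finset V).card :=
      coverNumber_le_card fun e he => by simp at he
    rw [Finset.card_empty] at h
    omega
  · obtain ⟨⟨e, f⟩, hef, hmin⟩ :=
      (E ×ˢ E).exists_min_image (fun p => (p.1 ∩ p.2).card) (hne.product hne)
    obtain ⟨he, hf⟩ := Finset.mem_product.1 hef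
    have hE : ∀ a ∈ E, ∀ b ∈ E, (e ∩ f).card ≤ (a ∩ b).card := fun a ha b hb =>
      hmin (a, b) (Finset.mk_mem_product ha hb)
    have htk : t ≤ (e ∩ f).card := by
      have h := hI e he f hf
      rwa [← Finset.coe_inter, Set.ncard_coe_finset] at h
    have hkr : (e ∩ f).card ≤ r := by
      have h := Finset.card_le_card_of_injOn (t := Finset.univ) part
        (fun v _ => Finset.mem_coe.2 (Finset.mem_univ _))
        ((hP.injOn he).mono (Finset.coe_subset.2 (Finset.inter_subset_left (s₂ := f))))
      rwa [Finset.card_univ, Fintype.card_fin] at h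
    rcases lt_or_ge r (3 * (e ∩ f).card) with hlt | hge
    · have h := coverNumber_le_of_card_inter_eq (c := (r - (e ∩ f).card) / 2 + 1) (x := 0)
        hP hE he hf rfl (by omega) (by omega) (by omega)
      omega
    · have h := coverNumber_le_of_card_inter_eq (c := (e ∩ f).card)
        (x := r - 3 * (e ∩ f).card + 1) hP hE he hf rfl le_rfl (by omega) (by omega)
      omega
end

section
/- For all integers r and t with 1 ≤ t and 3t ≤ r ≤ 5t − 2, every (r,t)-graph H satisfies τ(H) ≤ ⌊(9r − 14t)/8⌋ + 2. -/
open Finset Classical in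
/-- The number of coordinates in which two transversals agree. -/
noncomputable def agreement {ι V : Type} [Fintype ι] (φ ψ : ι → V) : ℕ :=
  (univ.filter fun j => φ j = ψ j).card

/-- Some set of at most `n` vertices meets every transversal in `F`. -/
def HasCoverOfCard {ι V : Type} (F : Set (ι → V)) (n : ℕ) : Prop :=
  ∃ C : Finset V, C.card ≤ n ∧ ∀ g ∈ F, ∃ j, g j ∈ C

theorem HasCoverOfCard.mono {ι V : Type} {F : Set (ι → V)} {m n : ℕ}
    (h : HasCoverOfCard F m) (hmn : m ≤ n) : HasCoverOfCard F n := by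
  obtain ⟨C, hC, hF⟩ := h
  exact ⟨C, hC.trans hmn, hF⟩

open Finset Classical in
/-- If, outside the sets `C j`, no vertex of coordinate `j` lies on more than `b j` of the
transversals `φ i`, and `∑ b j` is less than the total agreement forced on each transversal,
then the union of the `C j` is a cover. -/
theorem hasCoverOfCard_of_sum_lt {ι V : Type} [Fintype ι] {F : Set (ι → V)} {t m n : ℕ}
    (φ : Fin m → ι → V) (hφ : ∀ g ∈ F, ∀ i, t ≤ agreement (φ i) g)
    (C : ι → Finset V) (b : ι → ℕ)
    (hb : ∀ j v, v ∉ C j → ∑ i, (if φ i j = v then 1 else 0) ≤ b j)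
    (hs : ∑ j, b j < m * t) (hn : ∑ j, (C j).card ≤ n) : HasCoverOfCard F n := by
  refine ⟨univ.biUnion C, card_biUnion_le.trans hn, fun g hg => ?_⟩
  by_contra! h
  have hg' : ∀ j, g j ∉ C j := fun j hj => h j (mem_biUnion.2 ⟨j, mem_univ j, hj⟩)
  have h1 : m * t ≤ ∑ i, agreement (φ i) g := by
    simpa using card_nsmul_le_sum univ (fun i => agreement (φ i) g) t fun i _ => hφ g hg i
  have h2 : ∑ i, agreement (φ i) g ≤ ∑ j, b j := by
    simp only [agreement, card_filter]
    rw [sum_comm]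
    exact sum_le_sum fun j _ => hb j (g j) (hg' j)
  omega

open Finset Classical in
theorem hasCoverOfCard_of_pair {ι V : Type} [Fintype ι] {F : Set (ι → V)} {t c s : ℕ}
    {φ ψ : ι → V} (hφ : ∀ g ∈ F, t ≤ agreement φ g) (hψ : ∀ g ∈ F, t ≤ agreement ψ g)
    (hc : c ≤ agreement φ ψ) (hs : s + agreement φ ψ ≤ Fintype.card ι)
    (h : agreement φ ψ + Fintype.card ι < 2 * t + 2 * c + s) :
    HasCoverOfCard F (c + 2 * s) := by
  obtain ⟨X, hXA, rfl⟩ := exists_subset_card_eq hc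
  have hD : s ≤ (univ.filter fun j => ¬ φ j = ψ j).card := by
    have := card_filter_add_card_filter_not (s := (univ : Finset ι)) (fun j => φ j = ψ j)
    simp only [agreement, card_univ] at *
    omega
  obtain ⟨S, hSD, rfl⟩ := exists_subset_card_eq hD
  have hX : ∀ j ∈ X, φ j = ψ j := fun j hj => (mem_filter.1 (hXA hj)).2
  have hS : ∀ j ∈ S, φ j ≠ ψ j := fun j hj => (mem_filter.1 (hSD hj)).2
  refine hasCoverOfCard_of_sum_lt (t := t) ![φ, ψ] ?_
    (fun j => if j ∈ X then {φ j} else if j ∈ S then {φ j, ψ j} else ∅)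
    (fun j => if j ∈ X then 0 else if j ∈ S then 0 else if φ j = ψ j then 2 else 1) ?_ ?_ ?_
  · intro g hg i
    fin_cases i
    · exact hφ g hg
    · exact hψ g hg
  · intro j v hv
    have := hX j
    have := hS j
    simp only [Fin.sum_univ_two, Matrix.cons_val_zero, Matrix.cons_val_one]
    grind
  · have key : ∑ j, ((if j ∈ X then 0 else if j ∈ S then 0 else if φ j = ψ j then 2 else 1)
        + (2 * (if j ∈ X then 1 else 0) + (if j ∈ S then 1 else 0)))
        = ∑ j, ((if φ j = ψ j then 1 else 0) + 1) := by
      refine sum_congr rfl fun j _ => ?_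
      have := hX j
      have := hS j
      grind
    simp only [sum_add_distrib, ← mul_sum, ← card_filter, filter_mem_eq_inter, univ_inter,
      ← card_eq_sum_ones, card_univ] at key
    simp only [agreement] at h
    omega
  · have key : ∑ j, (if j ∈ X then {φ j} else if j ∈ S then {φ j, ψ j} else ∅ : Finset V).card
        ≤ ∑ j, ((if j ∈ X then 1 else 0) + 2 * (if j ∈ S then 1 else 0)) := by
      refine sum_le_sum fun j _ => ?_
      have := card_le_two (a := φ j) (b := ψ j)
      split_ifs <;> simp_all
    simp only [sum_add_distrib, ← mul_sum, ← card_filter, filter_mem_eq_inter, univ_inter] at key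
    exact key

open Finset Classical in
/-- The number of coordinates in which three transversals agree. -/
noncomputable def tripleAgreement {ι V : Type} [Fintype ι] (φ ψ χ : ι → V) : ℕ :=
  (univ.filter fun j => φ j = ψ j ∧ φ j = χ j).card

open Finset Classical in
/-- The number of coordinates in which exactly two of three transversals agree. -/
noncomputable def pairOnlyAgreement {ι V : Type} [Fintype ι] (φ ψ χ : ι → V) : ℕ :=
  (univ.filter fun j => ¬ (φ j = ψ j ∧ φ j = χ j) ∧
    (φ j = ψ j ∨ φ j = χ j ∨ ψ j = χ j)).card

open Finset Classical in
/-- The number of coordinates in which three transversals are pairwise different. -/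
noncomputable def tripleDisagreement {ι V : Type} [Fintype ι] (φ ψ χ : ι → V) : ℕ :=
  (univ.filter fun j => φ j ≠ ψ j ∧ φ j ≠ χ j ∧ ψ j ≠ χ j).card

open Finset Classical in
theorem triple_add_pairOnly_add_tripleDisagreement {ι V : Type} [Fintype ι] (φ ψ χ : ι → V) :
    tripleAgreement φ ψ χ + pairOnlyAgreement φ ψ χ + tripleDisagreement φ ψ χ
      = Fintype.card ι := by
  rw [← card_univ, card_eq_sum_ones]
  simp only [tripleAgreement, pairOnlyAgreement, tripleDisagreement, card_filter,
    ← sum_add_distrib]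
  exact sum_congr rfl fun j _ => by grind

open Finset Classical in
theorem agreement_add_agreement_add_agreement {ι V : Type} [Fintype ι] (φ ψ χ : ι → V) :
    agreement φ ψ + agreement φ χ + agreement ψ χ
      = 3 * tripleAgreement φ ψ χ + pairOnlyAgreement φ ψ χ := by
  simp only [tripleAgreement, pairOnlyAgreement, agreement, card_filter, mul_sum,
    ← sum_add_distrib]
  exact sum_congr rfl fun j _ => by grind

open Finset Classical in
theorem hasCoverOfCard_of_triple {ι V : Type} [Fintype ι] {F : Set (ι → V)} {t x y z : ℕ}
    {φ ψ χ : ι → V} (hφ : ∀ g ∈ F, t ≤ agreement φ g) (hψ : ∀ g ∈ F, t ≤ agreement ψ g)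
    (hχ : ∀ g ∈ F, t ≤ agreement χ g)
    (hx : x ≤ pairOnlyAgreement φ ψ χ) (hy : y ≤ x) (hz : z ≤ tripleDisagreement φ ψ χ)
    (h : 2 * pairOnlyAgreement φ ψ χ + tripleDisagreement φ ψ χ < 3 * t + x + y + z) :
    HasCoverOfCard F (tripleAgreement φ ψ χ + x + y + 3 * z) := by
  obtain ⟨X, hXA, rfl⟩ := exists_subset_card_eq hx
  obtain ⟨Y, hYX, rfl⟩ := exists_subset_card_eq hy
  obtain ⟨Z, hZN, rfl⟩ := exists_subset_card_eq hz
  have hX : ∀ j ∈ X, _ := fun j hj => (mem_filter.1 (hXA hj)).2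
  have hZ : ∀ j ∈ Z, _ := fun j hj => (mem_filter.1 (hZN hj)).2
  have hY : ∀ j ∈ Y, j ∈ X := fun j hj => hYX hj
  refine hasCoverOfCard_of_sum_lt (t := t) ![φ, ψ, χ] ?_
    (fun j => if φ j = ψ j ∧ φ j = χ j then {φ j} else
      if j ∈ Y ∨ j ∈ Z then {φ j, ψ j, χ j} else
      if j ∈ X then {if φ j = ψ j then φ j else χ j} else ∅)
    (fun j => if (φ j = ψ j ∧ φ j = χ j) ∨ j ∈ Y ∨ j ∈ Z then 0 else if j ∈ X then 1 else
      if φ j = ψ j ∨ φ j = χ j ∨ ψ j = χ j then 2 else 1) ?_ ?_ ?_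
  · intro g hg i
    fin_cases i
    · exact hφ g hg
    · exact hψ g hg
    · exact hχ g hg
  · intro j v hv
    have := hX j
    have := hY j
    have := hZ j
    simp only [Fin.sum_univ_three, Matrix.cons_val]
    grind
  · have key : ∑ j, ((if (φ j = ψ j ∧ φ j = χ j) ∨ j ∈ Y ∨ j ∈ Z then 0 else
        if j ∈ X then 1 else if φ j = ψ j ∨ φ j = χ j ∨ ψ j = χ j then 2 else 1)
        + ((if j ∈ X then 1 else 0) + (if j ∈ Y then 1 else 0) + (if j ∈ Z then 1 else 0)))
        = ∑ j, (2 * (if ¬ (φ j = ψ j ∧ φ j = χ j) ∧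
            (φ j = ψ j ∨ φ j = χ j ∨ ψ j = χ j) then 1 else 0)
          + (if φ j ≠ ψ j ∧ φ j ≠ χ j ∧ ψ j ≠ χ j then 1 else 0)) := by
      refine sum_congr rfl fun j _ => ?_
      have := hX j
      have := hY j
      have := hZ j
      grind
    simp only [sum_add_distrib, ← mul_sum, ← card_filter, filter_mem_eq_inter,
      univ_inter] at key
    simp only [pairOnlyAgreement, tripleDisagreement] at h
    omega
  · have key : ∑ j, (if φ j = ψ j ∧ φ j = χ j then {φ j} else
        if j ∈ Y ∨ j ∈ Z then {φ j, ψ j, χ j} else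
        if j ∈ X then {if φ j = ψ j then φ j else χ j} else ∅ : Finset V).card
        ≤ ∑ j, ((if φ j = ψ j ∧ φ j = χ j then 1 else 0) + (if j ∈ X then 1 else 0)
          + (if j ∈ Y then 1 else 0) + 3 * (if j ∈ Z then 1 else 0)) := by
      refine sum_le_sum fun j _ => ?_
      have hXj := hX j
      have hYj := hY j
      have h3 : ({φ j, ψ j, χ j} : Finset V).card ≤ 3 := card_le_three
      have h2 : (φ j = ψ j ∨ φ j = χ j ∨ ψ j = χ j) →
          ({φ j, ψ j, χ j} : Finset V).card ≤ 2 := by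
        have h4 := card_le_two (a := ψ j) (b := χ j)
        have h5 := card_le_two (a := φ j) (b := χ j)
        rintro (h | h | h)
        · simpa [h] using h4
        · simpa [h, pair_comm] using h4
        · simpa [h] using h5
      by_cases hQ : φ j = ψ j ∧ φ j = χ j
      · rw [if_pos hQ, if_pos hQ, card_singleton]
        omega
      rw [if_neg hQ, if_neg hQ]
      by_cases hjY : j ∈ Y
      · have := h2 (hXj (hYj hjY)).2
        simp only [hjY, hYj hjY, true_or, if_true]
        omega
      by_cases hjZ : j ∈ Z
      · simp only [hjZ, or_true, if_true]
        omega
      by_cases hjX : j ∈ X <;> simp [hjY, hjZ, hjX]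
    simp only [sum_add_distrib, ← mul_sum, ← card_filter, filter_mem_eq_inter,
      univ_inter] at key
    exact key

open Finset Classical in
/-- If no `n` vertices cover `F`, some transversal of `F` agrees with `φ` only inside `W`,
for any `W` omitting at most `n` coordinates. -/
theorem exists_agreement_subset {ι V : Type} [Fintype ι] {F : Set (ι → V)} {n : ℕ}
    (hF : ¬ HasCoverOfCard F n) (φ : ι → V) (W : Finset ι) (hW : Fintype.card ι ≤ n + W.card) :
    ∃ g ∈ F, ∀ j, φ j = g j → j ∈ W := by
  by_contra! h
  refine hF ⟨Wᶜ.image φ, card_image_le.trans ?_, fun g hg => ?_⟩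
  · rw [card_compl]
    omega
  · obtain ⟨j, hj, hjW⟩ := h g hg
    exact ⟨j, hj ▸ mem_image_of_mem φ (mem_compl.2 hjW)⟩

open Finset Classical in
theorem exists_agreement_bounds {ι V : Type} [Fintype ι] {F : Set (ι → V)} {n k s : ℕ}
    (hF : ¬ HasCoverOfCard F n) {φ ψ : ι → V} (hk : k ≤ agreement φ ψ)
    (hs : s + agreement φ ψ ≤ Fintype.card ι) (hn : Fintype.card ι ≤ n + k + s) :
    ∃ g ∈ F, tripleAgreement φ ψ g ≤ k ∧ agreement φ g ≤ tripleAgreement φ ψ g + s := by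
  obtain ⟨J, hJA, rfl⟩ := exists_subset_card_eq hk
  have hD : s ≤ (univ.filter fun j => ¬ φ j = ψ j).card := by
    have := card_filter_add_card_filter_not (s := (univ : Finset ι)) (fun j => φ j = ψ j)
    simp only [agreement, card_univ] at *
    omega
  obtain ⟨S, hSD, rfl⟩ := exists_subset_card_eq hD
  have hJ : ∀ j ∈ J, φ j = ψ j := fun j hj => (mem_filter.1 (hJA hj)).2
  have hS : ∀ j ∈ S, φ j ≠ ψ j := fun j hj => (mem_filter.1 (hSD hj)).2
  have hJS : Disjoint J S := disjoint_left.2 fun j h1 h2 => hS j h2 (hJ j h1)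
  obtain ⟨g, hg, hgW⟩ := exists_agreement_subset hF φ (J ∪ S)
    (by rw [card_union_of_disjoint hJS]; omega)
  refine ⟨g, hg, card_le_card fun j hj => ?_, ?_⟩
  · obtain ⟨h1, h2⟩ := (mem_filter.1 hj).2
    exact (mem_union.1 (hgW j h2)).resolve_right fun h => hS j h h1
  · refine (card_le_card (t := (univ.filter fun j => φ j = ψ j ∧ φ j = g j) ∪ S) ?_).trans
      (card_union_le _ _)
    intro j hj
    have h2 := (mem_filter.1 hj).2
    rcases mem_union.1 (hgW j h2) with h | h
    · exact mem_union_left _ (mem_filter.2 ⟨mem_univ j, hJ j h, h2⟩)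
    · exact mem_union_right _ h

theorem agreement_le_card {ι V : Type} [Fintype ι] (φ ψ : ι → V) :
    agreement φ ψ ≤ Fintype.card ι :=
  Finset.card_le_univ _

theorem hasCoverOfCard_card_sub {ι V : Type} [Fintype ι] {F : Set (ι → V)} {t n : ℕ}
    {φ : ι → V} (hφ : ∀ g ∈ F, t ≤ agreement φ g) (ht : 1 ≤ t)
    (hn : Fintype.card ι + 1 ≤ t + n) : HasCoverOfCard F n := by
  by_contra hF
  by_cases hn' : Fintype.card ι ≤ n
  · obtain ⟨g, hg, h⟩ := exists_agreement_subset hF φ ∅ (by simpa using hn')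
    have h1 := hφ g hg
    have h2 : agreement φ g = 0 := by simpa [agreement] using h
    omega
  · obtain ⟨W, -, hW⟩ := Finset.exists_subset_card_eq
      (s := (Finset.univ : Finset ι)) (n := Fintype.card ι - n)
      (by rw [Finset.card_univ]; omega)
    obtain ⟨g, hg, h⟩ := exists_agreement_subset hF φ W (by omega)
    have h1 := hφ g hg
    have h2 : agreement φ g ≤ W.card := Finset.card_le_card fun j hj => h j (by simpa using hj)
    omega

theorem exists_overlap_parameters {r t B : ℕ} (hr' : r + 2 ≤ 5 * t)
    (hB : 8 * B + 14 * t ≤ 9 * r + 16) (hB' : 9 * r + 16 < 8 * B + 14 * t + 8)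
    (hsingle : B + t < r + 1) (hpair : B + 5 * t < 2 * r + 2) :
    ∃ k s, r = B + k + s ∧ k ≤ t ∧ s + t ≤ r ∧ k + 3 * r + 3 ≤ B + 12 * t ∧
      r + k + 1 ≤ B + 2 * t ∧ 3 * s + 3 * r + 2 ≤ 8 * t + 2 * B := by
  obtain ⟨s, hs, hs'⟩ : ∃ s, 3 * s + 3 * r + 2 ≤ 8 * t + 2 * B ∧
      8 * t + 2 * B < 3 * s + 3 * r + 5 :=
    ⟨(8 * t + 2 * B - 3 * r - 2) / 3, by omega, by omega⟩
  obtain ⟨k, hk⟩ : ∃ k, r = B + k + s := ⟨r - B - s, by omega⟩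
  exact ⟨k, s, hk, by omega, by omega, by omega, by omega, hs⟩

/-- The bound for a `t`-intersecting family in which some pair agrees exactly `t` times. -/
theorem hasCoverOfCard_of_agreement_eq {V : Type} {r t B : ℕ} {F : Set (Fin r → V)}
    (hF : ∀ φ ∈ F, ∀ ψ ∈ F, t ≤ agreement φ ψ) (ht : 1 ≤ t) (hr : 3 * t ≤ r)
    (hr' : r + 2 ≤ 5 * t) (hB : B = (9 * r - 14 * t) / 8 + 2)
    {φ ψ : Fin r → V} (hφ : φ ∈ F) (hψ : ψ ∈ F) (h : agreement φ ψ = t) :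
    HasCoverOfCard F B := by
  by_contra hcov
  have hB₁ : 8 * B + 14 * t ≤ 9 * r + 16 := by omega
  have hB₂ : 9 * r + 16 < 8 * B + 14 * t + 8 := by omega
  clear hB
  have hsingle : B + t < r + 1 := by
    by_contra! h1
    exact hcov (hasCoverOfCard_card_sub (hF φ hφ) ht (by rw [Fintype.card_fin]; omega))
  have hpair : ∀ α ∈ F, ∀ β ∈ F, agreement α β + 2 * t ≤ r + 1 →
      B + agreement α β + 4 * t < 2 * r + 2 := by
    intro α hα β hβ hp
    by_contra! h1
    refine hcov ((hasCoverOfCard_of_pair (hF α hα) (hF β hβ) le_rfl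
      (s := r + 1 - agreement α β - 2 * t) ?_ ?_).mono ?_)
    all_goals try rw [Fintype.card_fin]
    all_goals clear hB₁ hB₂ hsingle
    all_goals omega
  have hpair' : ∀ α ∈ F, ∀ β ∈ F, r + 1 < agreement α β + 2 * t →
      2 * B + 2 * t < agreement α β + r + 2 := by
    intro α hα β hβ hp
    have h2 := agreement_le_card α β
    rw [Fintype.card_fin] at h2
    by_contra! h1
    obtain ⟨c, hc, hc'⟩ : ∃ c, 2 * c + 2 * t ≤ agreement α β + r + 2 ∧
        agreement α β + r < 2 * c + 2 * t :=
      ⟨(agreement α β + r - 2 * t) / 2 + 1, by omega, by omega⟩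
    refine hcov ((hasCoverOfCard_of_pair (hF α hα) (hF β hβ) (s := 0) (c := c) ?_ ?_ ?_).mono ?_)
    all_goals try rw [Fintype.card_fin]
    all_goals clear hB₁ hB₂ hsingle
    all_goals omega
  have h0 := hpair φ hφ ψ hψ (by omega)
  rw [h] at h0
  obtain ⟨k, s, hks, hkt, hst, hk₁, hk₂, hs⟩ :=
    exists_overlap_parameters hr' hB₁ hB₂ hsingle (by omega)
  have htB : t ≤ B := by omega
  clear hB₁ hB₂
  obtain ⟨χ, hχ, hq, hp⟩ := exists_agreement_bounds hcov (φ := φ) (ψ := ψ)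
    (k := k) (s := s) (by omega) (by rw [Fintype.card_fin]; omega)
    (by rw [Fintype.card_fin]; omega)
  have h13 := hF φ hφ χ hχ
  have h23 := hF ψ hψ χ hχ
  have hsum := agreement_add_agreement_add_agreement φ ψ χ
  have hcard := triple_add_pairOnly_add_tripleDisagreement φ ψ χ
  rw [Fintype.card_fin] at hcard
  have hsmall : agreement ψ χ + 2 * t ≤ r + 1 := by
    by_contra! h1
    have := hpair' ψ hψ χ hχ h1
    omega
  have h1 := hpair ψ hψ χ hχ hsmall
  have htriple := fun x y z => hasCoverOfCard_of_triple (t := t) (x := x) (y := y) (z := z)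
    (hF φ hφ) (hF ψ hψ) (hF χ hχ)
  generalize tripleAgreement φ ψ χ = q at *
  generalize pairOnlyAgreement φ ψ χ = a at *
  generalize tripleDisagreement φ ψ χ = n at *
  have ha : r + a + 1 ≤ B + 3 * t := by omega
  have hn : r + a + 2 * n + 3 ≤ B + 9 * t := by omega
  have hqB : q ≤ B := by omega
  clear h0 hks hkt hst hk₁ hk₂ hs hq hp h13 h23 hsum hsmall h1 hsingle hr hr' htB
  by_cases hd : 2 * a + n < 3 * t
  · exact hcov ((htriple 0 0 0 (by omega) (by omega) (by omega) (by omega)).mono (by omega))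
  by_cases hd1 : a + n < 3 * t
  · exact hcov ((htriple (2 * a + n + 1 - 3 * t) 0 0 (by omega) (by omega) (by omega)
      (by omega)).mono (by omega))
  by_cases hd2 : n < 3 * t
  · exact hcov ((htriple a (a + n + 1 - 3 * t) 0 (by omega) (by omega) (by omega)
      (by omega)).mono (by omega))
  · exact hcov ((htriple a a (n + 1 - 3 * t) (by omega) (by omega) (by omega)
      (by omega)).mono (by omega))

theorem hasCoverOfCard_of_agreement {V : Type} {r t B : ℕ} {F : Set (Fin r → V)}
    (hF : ∀ φ ∈ F, ∀ ψ ∈ F, t ≤ agreement φ ψ) (hr : 3 * t ≤ r)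
    (hr' : r + 2 ≤ 5 * t) (hB : B = (9 * r - 14 * t) / 8 + 2) :
    HasCoverOfCard F B := by
  rcases F.eq_empty_or_nonempty with rfl | ⟨φ₀, hφ₀⟩
  · exact ⟨∅, by simp, by simp⟩
  have hex : ∃ k, ∃ φ ∈ F, ∃ ψ ∈ F, agreement φ ψ = k := ⟨_, φ₀, hφ₀, φ₀, hφ₀, rfl⟩
  classical
  obtain ⟨φ, hφ, ψ, hψ, hk⟩ := Nat.find_spec hex
  have hmin : ∀ α ∈ F, ∀ β ∈ F, Nat.find hex ≤ agreement α β :=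
    fun α hα β hβ => Nat.find_min' hex ⟨α, hα, β, hβ, rfl⟩
  set k := Nat.find hex
  have htk : t ≤ k := hk ▸ hF φ hφ ψ hψ
  have hkr : k ≤ r := by simpa [hk] using agreement_le_card φ ψ
  by_cases h3 : 3 * k ≤ r
  · exact (hasCoverOfCard_of_agreement_eq hmin (by omega) h3 (by omega) rfl hφ hψ hk).mono
      (by omega)
  by_cases hkB : k ≤ B
  · refine (hasCoverOfCard_of_pair (hmin φ hφ) (hmin ψ hψ) (c := k) (s := 0)
      (by omega) (by simp [hk, hkr]) ?_).mono (by omega)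
    rw [Fintype.card_fin]
    omega
  · exact hasCoverOfCard_card_sub (hmin φ hφ) (by omega) (by rw [Fintype.card_fin]; omega)

open Classical in
/-- The transversals of the parts whose vertices all lie in a common edge. -/
def edgeTransversals {V : Type} {r : ℕ} (part : V → Fin r) (E : Finset (Finset V)) :
    Set (Fin r → V) :=
  {φ | ∃ e ∈ E, ∀ j, e.filter (fun v => part v = j) = {φ j}}

theorem le_agreement_of_mem_edgeTransversals {V : Type} {r t : ℕ} {part : V → Fin r}
    {E : Finset (Finset V)} (hI : IntersectingGe t E) {φ ψ : Fin r → V}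
    (hφ : φ ∈ edgeTransversals part E) (hψ : ψ ∈ edgeTransversals part E) :
    t ≤ agreement φ ψ := by
  classical
  obtain ⟨e, he, hφ⟩ := hφ
  obtain ⟨f, hf, hψ⟩ := hψ
  refine (hI e he f hf).trans ?_
  rw [← Finset.coe_inter, Set.ncard_coe_finset]
  refine (Finset.card_le_card (t := (Finset.univ.filter fun j => φ j = ψ j).image φ)
    fun v hv => ?_).trans Finset.card_image_le
  have h1 : v = φ (part v) := by
    rw [← Finset.mem_singleton, ← hφ]
    simp [(Finset.mem_inter.1 hv).1]
  have h2 : v = ψ (part v) := by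
    rw [← Finset.mem_singleton, ← hψ]
    simp [(Finset.mem_inter.1 hv).2]
  exact Finset.mem_image.2 ⟨part v, by simp [← h1, ← h2], h1.symm⟩

theorem coverNumber_le_of_hasCoverOfCard {V : Type} {r n : ℕ} {part : V → Fin r}
    {E : Finset (Finset V)} (hP : IsRPartite r part E)
    (h : HasCoverOfCard (edgeTransversals part E) n) : coverNumber E ≤ n := by
  obtain ⟨C, hC, hcov⟩ := h
  refine le_trans (Nat.sInf_le ⟨C, fun e he => ?_, rfl⟩) hC
  choose φ hφ using fun j => Finset.card_eq_one.1 (hP e he j)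
  obtain ⟨j, hj⟩ := hcov φ ⟨e, he, fun j => by convert hφ j⟩
  refine ⟨φ j, Finset.mem_of_mem_filter (p := fun v => part v = j) (φ j) ?_, hj⟩
  rw [hφ j]
  exact Finset.mem_singleton_self _

/-- **Third case of Theorem 1.4**: for `t ≥ 1` and `3t ≤ r ≤ 5t - 2`, every
`(r,t)`-graph `H` satisfies `τ(H) ≤ ⌊(9r - 14t)/8⌋ + 2`. -/
theorem cover_le_nine_r_sub_fourteen_t_div_eight {V : Type} [Fintype V] (r t : ℕ)
    (ht : 1 ≤ t) (hr : 3 * t ≤ r) (hr' : (r : ℤ) ≤ 5 * (t : ℤ) - 2)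
    (part : V → Fin r) (E : Finset (Finset V))
    (hP : IsRPartite r part E) (hI : IntersectingGe t E) :
    (coverNumber E : ℤ) ≤ (9 * (r : ℤ) - 14 * (t : ℤ)) / 8 + 2 := by
  have hcov := coverNumber_le_of_hasCoverOfCard hP (hasCoverOfCard_of_agreement
    (fun _ hφ _ hψ => le_agreement_of_mem_edgeTransversals hI hφ hψ) hr (by omega) rfl)
  omega
end

section
/- For all integers r and t with 1 ≤ t, 5t − 1 ≤ r and 9r ≤ 52t − 13, every (r,t)-graph H satisfies τ(H) ≤ ⌊(15r − 44t)/8⌋ + 3. -/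
open Finset

section Agreement

variable {ι V : Type} [Fintype ι] [DecidableEq V]

/-- The set of indices at which two functions agree. -/
def agreeSet (x y : ι → V) : Finset ι := univ.filter fun j => x j = y j

@[simp] lemma mem_agreeSet {x y : ι → V} {j : ι} : j ∈ agreeSet x y ↔ x j = y j := by
  simp [agreeSet]

/-- A family of functions that pairwise agree in at least `t` places and is not met by any set of
at most `T` values. -/
structure HardFamily (t T : ℕ) (F : Set (ι → V)) : Prop where
  inter : ∀ x ∈ F, ∀ y ∈ F, t ≤ (agreeSet x y).card
  avoid : ∀ C : Finset V, C.card ≤ T → ∃ x ∈ F, ∀ j, x j ∉ C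

lemma card_agreeSet_triangle [DecidableEq ι] (x y z : ι → V) :
    (agreeSet x y).card + (agreeSet y z).card ≤ (agreeSet x z).card + Fintype.card ι := by
  have h₁ := card_union_add_card_inter (agreeSet x y) (agreeSet y z)
  have h₂ : (agreeSet x y ∩ agreeSet y z).card ≤ (agreeSet x z).card :=
    card_le_card fun j => by simp only [mem_inter, mem_agreeSet]; exact fun h => h.1.trans h.2
  have h₃ := card_le_univ (agreeSet x y ∪ agreeSet y z)
  omega

namespace HardFamily

variable {t T : ℕ} {F : Set (ι → V)}

/-- If a set of values lies on three members at the index sets `X`, `Y`, `Z`, it is avoided by a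
member unless it has more than `T` elements. -/
lemma exists_avoid_three (hF : HardFamily t T F) (e f g : ι → V) (X Y Z : Finset ι)
    (hc : X.card + Y.card + Z.card ≤ T) :
    ∃ h ∈ F, (∀ j ∈ X, h j ≠ e j) ∧ (∀ j ∈ Y, h j ≠ f j) ∧ ∀ j ∈ Z, h j ≠ g j := by
  obtain ⟨h, hh, hav⟩ := hF.avoid (X.image e ∪ Y.image f ∪ Z.image g) (by
    have h₁ := card_union_le (X.image e ∪ Y.image f) (Z.image g)
    have h₂ := card_union_le (X.image e) (Y.image f)
    have h₃ := card_image_le (s := X) (f := e)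
    have h₄ := card_image_le (s := Y) (f := f)
    have h₅ := card_image_le (s := Z) (f := g)
    omega)
  simp only [mem_union, mem_image, not_or, not_exists, not_and] at hav
  exact ⟨h, hh, fun j hj he => (hav j).1.1 j hj he.symm, fun j hj he => (hav j).1.2 j hj he.symm,
    fun j hj he => (hav j).2 j hj he.symm⟩

variable [DecidableEq ι]

lemma exists_agreeSet_subset (hF : HardFamily t T F) (e : ι → V) (P : Finset ι)
    (hP : Fintype.card ι ≤ T + P.card) : ∃ g ∈ F, agreeSet e g ⊆ P := by
  obtain ⟨g, hg, h⟩ := hF.avoid (Pᶜ.image e) (card_image_le.trans (by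
    rw [card_compl]; omega))
  refine ⟨g, hg, fun j hj => ?_⟩
  by_contra hjP
  exact h j (mem_image.2 ⟨j, mem_compl.2 hjP, mem_agreeSet.1 hj⟩)

lemma card_agreeSet_lt_or (hF : HardFamily t T F) (ht : 1 ≤ t) {e f : ι → V}
    (he : e ∈ F) (hf : f ∈ F) :
    T < (agreeSet e f).card ∨
      T + 4 * t + (agreeSet e f).card ≤ 2 * Fintype.card ι + 1 := by
  by_contra! hcon
  have hle := card_le_univ (agreeSet e f)
  have hcompl : (agreeSet e f)ᶜ.card = Fintype.card ι - (agreeSet e f).card := card_compl _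
  obtain ⟨B, hB, hBc⟩ := exists_subset_card_eq
    (s := (agreeSet e f)ᶜ) (n := (agreeSet e f)ᶜ.card + 1 - 2 * t) (by omega)
  obtain ⟨h, hh, h₁, h₂, -⟩ := hF.exists_avoid_three e f f (agreeSet e f ∪ B) B ∅ (by
    have := card_union_le (agreeSet e f) B
    simp only [card_empty]
    omega)
  have hd : Disjoint (agreeSet h e) (agreeSet h f) := by
    rw [disjoint_left]; intro j hj hj'
    rw [mem_agreeSet] at hj hj'
    exact h₁ j (mem_union_left _ (mem_agreeSet.2 (hj.symm.trans hj'))) hj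
  have hs : agreeSet h e ∪ agreeSet h f ⊆ (agreeSet e f)ᶜ \ B := by
    intro j; have := h₁ j; have := h₂ j
    simp only [mem_union, mem_agreeSet, mem_sdiff, mem_compl] at *
    grind
  have := card_le_card hs
  rw [card_union_of_disjoint hd, card_sdiff_of_subset hB] at this
  have := hF.inter h hh e he
  have := hF.inter h hh f hf
  omega

/-- The covers obtained from three members: block all values taken at least twice, then as many
further values as necessary. -/
lemma three_members (hF : HardFamily t T F) (ht : 1 ≤ t) {e f g : ι → V}
    (he : e ∈ F) (hf : f ∈ F) (hg : g ∈ F) :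
    ∃ b d : ℕ,
      b + 3 * (agreeSet e f ∩ agreeSet e g).card =
        (agreeSet e f).card + (agreeSet e g).card + (agreeSet f g).card ∧
      (agreeSet e f ∩ agreeSet e g).card + b + d = Fintype.card ι ∧
      (3 * t ≤ d ∧ T + 9 * t + 2 * (agreeSet e f ∩ agreeSet e g).card + b ≤
          3 * Fintype.card ι + 2 ∨
        d < 3 * t ∧ (T < (agreeSet e f ∩ agreeSet e g).card + b ∨
          T + 3 * t ≤ Fintype.card ι + b)) := by
  set A := agreeSet e f ∩ agreeSet e g with hA
  set X := agreeSet e f \ agreeSet e g with hX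
  set Y := agreeSet e g \ agreeSet e f with hY
  set Z := agreeSet f g \ agreeSet e f with hZ
  set D := (A ∪ (X ∪ Y ∪ Z))ᶜ with hD
  have hXc : X.card + A.card = (agreeSet e f).card := card_sdiff_add_card_inter _ _
  have hYc : Y.card + A.card = (agreeSet e g).card := by
    rw [hA, inter_comm]; exact card_sdiff_add_card_inter _ _
  have hZc : Z.card + A.card = (agreeSet f g).card := by
    have : A = agreeSet f g ∩ agreeSet e f := by
      ext j; simp only [hA, mem_inter, mem_agreeSet]; grind
    rw [this]; exact card_sdiff_add_card_inter _ _
  have hXY : Disjoint X Y := by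
    rw [disjoint_left]; intro j; simp only [hX, hY, mem_sdiff]; tauto
  have hXYZ : Disjoint (X ∪ Y) Z := by
    rw [disjoint_left]; intro j
    simp only [hX, hY, hZ, mem_union, mem_sdiff, mem_agreeSet]; grind
  have hAB : Disjoint A (X ∪ Y ∪ Z) := by
    rw [disjoint_left]; intro j
    simp only [hA, hX, hY, hZ, mem_inter, mem_union, mem_sdiff, mem_agreeSet]; tauto
  have hBc : (X ∪ Y ∪ Z).card = X.card + Y.card + Z.card := by
    rw [card_union_of_disjoint hXYZ, card_union_of_disjoint hXY]
  have hABc := card_union_of_disjoint hAB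
  have hDc := card_add_card_compl (A ∪ (X ∪ Y ∪ Z))
  rw [← hD] at hDc
  have key : ∀ h ∈ F, ∀ S : Finset ι, (∀ j, (h j = e j → j ∈ S ∧ h j ≠ f j ∧ h j ≠ g j) ∧
      (h j = f j → j ∈ S ∧ h j ≠ g j) ∧ (h j = g j → j ∈ S)) → 3 * t ≤ S.card := by
    intro h hh S hS
    have h₁ : Disjoint (agreeSet h e) (agreeSet h f) := by
      rw [disjoint_left]; intro j; simp only [mem_agreeSet]; grind
    have h₂ : Disjoint (agreeSet h e ∪ agreeSet h f) (agreeSet h g) := by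
      rw [disjoint_left]; intro j; simp only [mem_union, mem_agreeSet]; grind
    have h₃ : agreeSet h e ∪ agreeSet h f ∪ agreeSet h g ⊆ S := by
      intro j; simp only [mem_union, mem_agreeSet]; grind
    have := card_le_card h₃
    rw [card_union_of_disjoint h₂, card_union_of_disjoint h₁] at this
    have := hF.inter h hh e he
    have := hF.inter h hh f hf
    have := hF.inter h hh g hg
    omega
  refine ⟨X.card + Y.card + Z.card, D.card, by omega, by omega, ?_⟩
  rcases le_or_gt (3 * t) D.card with hd | hd
  · refine Or.inl ⟨hd, ?_⟩
    by_contra! hcon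
    obtain ⟨W, hW, hWc⟩ := exists_subset_card_eq (s := D) (n := D.card + 1 - 3 * t) (by omega)
    obtain ⟨h, hh, h₁, h₂, h₃⟩ := hF.exists_avoid_three e f g (A ∪ (X ∪ Y ∪ Z) ∪ W)
      (Y ∪ Z ∪ W) (X ∪ W) (by
        have := card_union_le (A ∪ (X ∪ Y ∪ Z)) W
        have := card_union_le (Y ∪ Z) W
        have := card_union_le Y Z
        have := card_union_le X W
        omega)
    have := key h hh (D \ W) fun j => by
      have h₁ := h₁ j
      have h₂ := h₂ j
      have h₃ := h₃ j
      simp only [hD, hA, hX, hY, hZ, mem_union, mem_inter, mem_sdiff, mem_compl,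
        mem_agreeSet] at h₁ h₂ h₃ ⊢
      clear * - h₁ h₂ h₃
      by_cases e j = f j <;> by_cases e j = g j <;> by_cases f j = g j <;> grind
    rw [card_sdiff_of_subset hW] at this
    omega
  · refine Or.inr ⟨hd, ?_⟩
    by_contra! hcon
    obtain ⟨W, hW, hWc⟩ := exists_subset_card_eq (s := X ∪ Y ∪ Z)
      (n := X.card + Y.card + Z.card + D.card + 1 - 3 * t) (by omega)
    have hWc' : W.card = (W ∩ X).card + (W ∩ Y).card + (W ∩ Z).card := by
      rw [← card_union_of_disjoint (hXY.mono inter_subset_right inter_subset_right),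
        ← inter_union_distrib_left,
        ← card_union_of_disjoint (hXYZ.mono inter_subset_right inter_subset_right),
        ← inter_union_distrib_left, inter_eq_left.2 hW]
    obtain ⟨h, hh, h₁, h₂, h₃⟩ := hF.exists_avoid_three e f g (A ∪ (X ∪ Y) ∪ W ∩ Z)
      (Z ∪ W ∩ Y) (W ∩ X) (by
        have := card_union_le (A ∪ (X ∪ Y)) (W ∩ Z)
        have := card_union_le A (X ∪ Y)
        have := card_union_le X Y
        have := card_union_le Z (W ∩ Y)
        omega)
    have := key h hh ((X ∪ Y ∪ Z) \ W ∪ D) fun j => by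
      have h₁ := h₁ j
      have h₂ := h₂ j
      have h₃ := h₃ j
      simp only [hD, hA, hX, hY, hZ, mem_union, mem_inter, mem_sdiff, mem_compl,
        mem_agreeSet] at h₁ h₂ h₃ ⊢
      clear * - h₁ h₂ h₃
      by_cases e j = f j <;> by_cases e j = g j <;> by_cases f j = g j <;> grind
    have hu := card_union_le ((X ∪ Y ∪ Z) \ W) D
    rw [card_sdiff_of_subset hW] at hu
    omega

/-- No such family exists in the stated range. Among the members agreeing with `f` in more than `T`
places and meeting `e` in few, one can always find one that shares fewer places with `e ∩ f`, until
it is too far from `f`. -/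
lemma false_of_bounds (hF : HardFamily t T F)
    (hr : 5 * t ≤ Fintype.card ι + 1) (hr' : 9 * Fintype.card ι + 13 ≤ 52 * t)
    (hr'' : 7 * Fintype.card ι + 17 ≤ 36 * t)
    (hT : 15 * Fintype.card ι + 17 ≤ 8 * T + 44 * t)
    (hT' : 8 * T + 44 * t ≤ 15 * Fintype.card ι + 24) : False := by
  have ht : 1 ≤ t := by omega
  obtain ⟨e, he, -⟩ := hF.avoid ∅ (by simp)
  obtain ⟨p, hp⟩ : ∃ p, p + T = Fintype.card ι := ⟨Fintype.card ι - T, by omega⟩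
  have hsub : ∀ P : Finset ι, P.card = p → ∃ g ∈ F, agreeSet e g ⊆ P := fun P hP =>
    hF.exists_agreeSet_subset e P (by omega)
  obtain ⟨P, -, hP⟩ := exists_subset_card_eq (s := (univ : Finset ι)) (n := p) (by
    rw [card_univ]; omega)
  obtain ⟨f, hf, hfP⟩ := hsub P hP
  have hfp : (agreeSet e f).card ≤ p := hP ▸ card_le_card hfP
  suffices H : ∀ n, ∀ h ∈ F, (agreeSet e h).card ≤ p → T < (agreeSet f h).card →
      (agreeSet e h ∩ agreeSet e f).card = n → False by
    refine H _ f hf hfp ?_ rfl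
    have : agreeSet f f = univ := by ext; simp
    rw [this, card_univ]
    have := hF.inter e he f hf
    omega
  intro n
  induction n using Nat.strong_induction_on with
  | _ n ih =>
  intro h hh hhp hfh hn
  have hth := hF.inter e he h hh
  have htf := hF.inter e he f hf
  have hpos : 0 < n := by
    by_contra hn0
    obtain ⟨b, d, h₁, h₂, -⟩ := hF.three_members ht he hf hh
    rw [inter_comm] at h₁ h₂
    omega
  obtain ⟨j₀, hj₀⟩ := card_pos.1 (hn ▸ hpos)
  have hj₀h := (mem_inter.1 hj₀).1
  obtain ⟨y, hy⟩ : ∃ y, y + 3 * Fintype.card ι + 3 = (agreeSet e h).card + 11 * t + T :=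
    ⟨(agreeSet e h).card + 11 * t + T - (3 * Fintype.card ι + 3), by omega⟩
  obtain ⟨Y, hY, hYc⟩ := exists_subset_card_eq (s := (agreeSet e h).erase j₀) (n := y) (by
    rw [card_erase_of_mem hj₀h]; omega)
  obtain ⟨Z, hZ, hZc⟩ := exists_subset_card_eq (s := (agreeSet e h ∪ agreeSet e f)ᶜ)
    (n := p - y) (by
      have := card_union_le (agreeSet e h) (agreeSet e f)
      rw [card_compl]; omega)
  have hYZ := card_union_le Y Z
  have hYZd : Disjoint Y Z := by
    rw [disjoint_left]; intro j hjY hjZ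
    have := hY hjY
    have := hZ hjZ
    simp_all
  obtain ⟨g, hg, hgP⟩ := hsub (Y ∪ Z) (by rw [card_union_of_disjoint hYZd]; omega)
  have hgp : (agreeSet e g).card ≤ p := (card_le_card hgP).trans (by omega)
  have htg := hF.inter e he g hg
  have hlt : (agreeSet e g ∩ agreeSet e f).card < n := by
    rw [← hn]
    have hmem : ∀ j ∈ agreeSet e g ∩ agreeSet e f, j ∈ Y := fun j hj => by
      have hjg := hgP (mem_inter.1 hj).1
      have hjf := (mem_inter.1 hj).2
      refine (mem_union.1 hjg).resolve_right fun hjZ => ?_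
      exact mem_compl.1 (hZ hjZ) (mem_union_right _ hjf)
    refine card_lt_card ⟨fun j hj => ?_, fun hs => ?_⟩
    · exact mem_inter.2 ⟨mem_of_mem_erase (hY (hmem j hj)), (mem_inter.1 hj).2⟩
    · exact notMem_erase _ _ (hY (hmem j₀ (hs hj₀)))
  rcases hF.card_agreeSet_lt_or ht hh hg with hhg | hhg
  · refine ih _ hlt g hg hgp ?_ rfl
    have := card_agreeSet_triangle f h g
    rcases hF.card_agreeSet_lt_or ht hf hg with h | h
    · exact h
    · omega
  · have ha : (agreeSet e h ∩ agreeSet e g).card ≤ y := by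
      rw [← hYc]; exact card_le_card fun j hj =>
        (mem_union.1 (hgP (mem_inter.1 hj).2)).resolve_right fun hjZ =>
          mem_compl.1 (hZ hjZ) (mem_union_left _ (mem_inter.1 hj).1)
    have hau : (agreeSet e g).card ≤ (agreeSet e h ∩ agreeSet e g).card + (p - y) := by
      rw [← hZc, inter_comm, ← card_inter_add_card_sdiff (agreeSet e g) (agreeSet e h)]
      exact Nat.add_le_add_left (card_le_card fun j hj =>
        (mem_union.1 (hgP (mem_sdiff.1 hj).1)).resolve_left fun hjY =>
          (mem_sdiff.1 hj).2 (mem_of_mem_erase (hY hjY))) _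
    have := hF.inter h hh g hg
    obtain ⟨b, d, h₁, h₂, h₃⟩ := hF.three_members ht he hh hg
    omega

end HardFamily

end Agreement

lemma exists_hardFamily {V : Type} [DecidableEq V] {r t T : ℕ} {part : V → Fin r}
    {E : Finset (Finset V)} (hP : IsRPartite r part E) (hI : IntersectingGe t E)
    (hT : T < coverNumber E) : ∃ F : Set (Fin r → V), HardFamily t T F := by
  have hchoose : ∀ e ∈ E, ∃ x : Fin r → V, (∀ j, part (x j) = j) ∧ e = univ.image x := by
    intro e he
    choose x hx using fun j => card_eq_one.1 (hP e he j)
    have hx' : ∀ j v, (v ∈ e ∧ part v = j) ↔ v = x j := fun j v => by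
      rw [← mem_filter (p := fun v => part v = j), hx j, mem_singleton]
    refine ⟨x, fun j => ((hx' j _).2 rfl).2, ?_⟩
    ext v
    simp only [mem_image, mem_univ, true_and]
    exact ⟨fun hv => ⟨part v, ((hx' _ v).1 ⟨hv, rfl⟩).symm⟩,
      fun ⟨j, hj⟩ => hj ▸ ((hx' j _).2 rfl).1⟩
  refine ⟨{x | (∀ j, part (x j) = j) ∧ univ.image x ∈ E}, ?_, ?_⟩
  · rintro x ⟨hx, hxE⟩ y ⟨hy, hyE⟩
    refine (hI _ hxE _ hyE).trans ?_
    rw [← coe_inter, Set.ncard_coe_finset]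
    refine (card_le_card (t := (agreeSet x y).image x) fun v hv => ?_).trans card_image_le
    simp only [mem_inter, mem_image, mem_univ, true_and, mem_agreeSet] at hv ⊢
    obtain ⟨⟨i, rfl⟩, j, hj⟩ := hv
    have : j = i := by rw [← hy j, hj, hx]
    exact ⟨i, by rw [← hj, this], rfl⟩
  · intro C hC
    by_contra! hcon
    suffices hcov : IsCover E C from
      (hT.trans_le (Nat.sInf_le ⟨C, hcov, rfl⟩)).not_ge hC
    intro e he
    obtain ⟨x, hx, rfl⟩ := hchoose e he
    obtain ⟨j, hj⟩ := hcon x ⟨hx, he⟩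
    exact ⟨x j, mem_image_of_mem _ (mem_univ j), hj⟩

/-- **Fourth case of Theorem 1.4**: for `t ≥ 1`, `5t - 1 ≤ r` and `9r ≤ 52t - 13`,
every `(r,t)`-graph `H` satisfies `τ(H) ≤ ⌊(15r - 44t)/8⌋ + 3`. -/
theorem cover_le_fifteen_r_sub_fortyfour_t_div_eight {V : Type} [Fintype V] (r t : ℕ)
    (ht : 1 ≤ t) (hr : 5 * (t : ℤ) - 1 ≤ (r : ℤ)) (hr' : 9 * (r : ℤ) ≤ 52 * (t : ℤ) - 13)
    (part : V → Fin r) (E : Finset (Finset V))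
    (hP : IsRPartite r part E) (hI : IntersectingGe t E) :
    (coverNumber E : ℤ) ≤ (15 * (r : ℤ) - 44 * (t : ℤ)) / 8 + 3 := by
  classical
  by_contra! hcon
  obtain ⟨T, hT⟩ : ∃ T : ℕ, (T : ℤ) = (15 * (r : ℤ) - 44 * (t : ℤ)) / 8 + 3 :=
    ⟨((15 * (r : ℤ) - 44 * (t : ℤ)) / 8 + 3).toNat, by omega⟩
  obtain ⟨F, hF⟩ := exists_hardFamily (T := T) hP hI (by omega)
  rcases le_or_gt (7 * r + 17) (36 * t) with h | h
  · refine hF.false_of_bounds ?_ ?_ ?_ ?_ ?_ <;> rw [Fintype.card_fin] <;> omega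
  · obtain ⟨e, he, -⟩ := hF.avoid ∅ (by simp)
    obtain ⟨P, -, hP⟩ := exists_subset_card_eq (s := (univ : Finset (Fin r))) (n := t - 1) (by
      rw [card_univ, Fintype.card_fin]; omega)
    obtain ⟨g, hg, hgP⟩ := hF.exists_agreeSet_subset e P (by rw [Fintype.card_fin]; omega)
    have := hF.inter e he g hg
    have := card_le_card hgP
    omega
end

section
/- For all integers k ≥ 2 and 1 ≤ t ≤ r, there exists an r-uniform r-partite k-wise t-intersecting hypergraph H with τ(H) = ⌊(r−t)/k⌋ + 1. -/
/-- The hypergraph with edge set `E` is `k`-wise `t`-intersecting: any `k` edges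
(repetitions allowed) have at least `t` common vertices. -/
def KWiseIntersecting {V : Type} (k t : ℕ) (E : Finset (Finset V)) : Prop :=
  ∀ f : Fin k → Finset V, (∀ i, f i ∈ E) → t ≤ (⋂ i, (↑(f i) : Set V)).ncard

/-- The graph of `g`, as a finite set of pairs. -/
def graphFinset {r n : ℕ} (g : Fin r → Fin n) : Finset (Fin r × Fin n) :=
  Finset.univ.image fun j => (j, g j)

theorem mem_graphFinset {r n : ℕ} {g : Fin r → Fin n} {v : Fin r × Fin n} :
    v ∈ graphFinset g ↔ g v.1 = v.2 := by
  obtain ⟨a, b⟩ := v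
  simp [graphFinset]

/-- The graphs of the functions `Fin r → Fin (m + 1)` with at most `m` nonzero values. -/
def sparseGraphs (r m : ℕ) : Finset (Finset (Fin r × Fin (m + 1))) :=
  (Finset.univ.filter fun g : Fin r → Fin (m + 1) =>
    (Finset.univ.filter fun j => g j ≠ 0).card ≤ m).image graphFinset

theorem mem_sparseGraphs {r m : ℕ} {e : Finset (Fin r × Fin (m + 1))} :
    e ∈ sparseGraphs r m ↔ ∃ g : Fin r → Fin (m + 1),
      (Finset.univ.filter fun j => g j ≠ 0).card ≤ m ∧ graphFinset g = e := by
  simp [sparseGraphs]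

theorem isRPartite_sparseGraphs (r m : ℕ) : IsRPartite r Prod.fst (sparseGraphs r m) := by
  intro e he j
  obtain ⟨g, -, rfl⟩ := mem_sparseGraphs.1 he
  rw [Finset.card_eq_one]
  refine ⟨(j, g j), ?_⟩
  ext ⟨a, b⟩
  simp only [Finset.mem_filter, mem_graphFinset, Finset.mem_singleton, Prod.mk.injEq]
  grind

theorem kWiseIntersecting_sparseGraphs {r m k t : ℕ} (h : t + k * m ≤ r) :
    KWiseIntersecting k t (sparseGraphs r m) := by
  intro f hf
  choose g hg hgf using fun i => mem_sparseGraphs.1 (hf i)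
  let B : Finset (Fin r) := Finset.univ.biUnion fun i => Finset.univ.filter fun j => g i j ≠ 0
  have hB : B.card ≤ k * m := by
    simpa using Finset.card_biUnion_le_card_mul Finset.univ
      (fun i => Finset.univ.filter fun j => g i j ≠ 0) m (fun i _ => hg i)
  have hBc : t ≤ (Bᶜ.image fun j => (j, (0 : Fin (m + 1)))).card := by
    rw [Finset.card_image_of_injective _ (Prod.mk_left_injective _), Finset.card_compl,
      Fintype.card_fin]
    omega
  rw [← Set.ncard_coe_finset] at hBc
  refine hBc.trans (Set.ncard_le_ncard ?_ (Set.toFinite _))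
  intro v hv
  obtain ⟨j, hj, rfl⟩ := Finset.mem_image.1 (Finset.mem_coe.1 hv)
  refine Set.mem_iInter.2 fun i => ?_
  rw [← hgf i, Finset.mem_coe, mem_graphFinset]
  simp only [B, Finset.mem_compl, Finset.mem_biUnion, Finset.mem_filter, Finset.mem_univ,
    true_and, not_exists, not_not] at hj
  exact hj i

theorem exists_isCover_sparseGraphs {r m : ℕ} (h : m + 1 ≤ r) :
    ∃ C, IsCover (sparseGraphs r m) C ∧ C.card = m + 1 := by
  obtain ⟨S, -, hS⟩ := Finset.exists_subset_card_eq
    (s := (Finset.univ : Finset (Fin r))) (n := m + 1) (by simpa using h)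
  refine ⟨S.image fun j => (j, 0), ?_, ?_⟩
  · intro e he
    obtain ⟨g, hg, rfl⟩ := mem_sparseGraphs.1 he
    obtain ⟨j, hjS, hj⟩ := Finset.exists_mem_notMem_of_card_lt_card
      (s := Finset.univ.filter fun j => g j ≠ 0) (t := S) (by omega)
    refine ⟨(j, 0), ?_, Finset.mem_image_of_mem _ hjS⟩
    simpa [mem_graphFinset] using hj
  · rw [Finset.card_image_of_injective _ (Prod.mk_left_injective _), hS]

theorem lt_card_of_isCover_sparseGraphs {r m : ℕ} {C : Finset (Fin r × Fin (m + 1))}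
    (hC : IsCover (sparseGraphs r m) C) : m < C.card := by
  by_contra! hcard
  have hfree : ∀ j : Fin r, ∃ x : Fin (m + 1), (j, x) ∉ C := by
    intro j
    by_contra! hj
    have hle := Finset.card_le_card_of_injOn (s := Finset.univ) (t := C)
      (fun x : Fin (m + 1) => (j, x)) (fun x _ => hj x) (Prod.mk_right_injective j).injOn
    rw [Finset.card_univ, Fintype.card_fin] at hle
    omega
  choose x hx using hfree
  let g : Fin r → Fin (m + 1) := fun j => if (j, 0) ∈ C then x j else 0
  have hgC : ∀ j, (j, g j) ∉ C := by
    intro j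
    by_cases hj : (j, 0) ∈ C
    · simpa [g, hj] using hx j
    · simp [g, hj]
  have hg : (Finset.univ.filter fun j => g j ≠ 0).card ≤ m := by
    refine le_trans (Finset.card_le_card_of_injOn (fun j => (j, (0 : Fin (m + 1)))) ?_
      (Prod.mk_left_injective _).injOn) hcard
    intro j hj
    by_contra hjC
    simp_all [g]
  obtain ⟨⟨j, y⟩, hv, hvC⟩ := hC _ (mem_sparseGraphs.2 ⟨g, hg, rfl⟩)
  have hy : g j = y := mem_graphFinset.1 hv
  exact hgC j (hy ▸ hvC)

theorem coverNumber_sparseGraphs {r m : ℕ} (h : m + 1 ≤ r) :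
    coverNumber (sparseGraphs r m) = m + 1 := by
  refine le_antisymm (Nat.sInf_le (exists_isCover_sparseGraphs h)) ?_
  refine le_csInf ⟨_, exists_isCover_sparseGraphs h⟩ ?_
  rintro _ ⟨C, hC, rfl⟩
  exact lt_card_of_isCover_sparseGraphs hC

/-- **Theorem 1.6** (tightness): for all `k ≥ 2` and `1 ≤ t ≤ r` there is an
`r`-uniform `r`-partite `k`-wise `t`-intersecting hypergraph `H` with
`τ(H) = ⌊(r - t)/k⌋ + 1`. -/
theorem exists_kwise_graph_cover_eq (r t k : ℕ) (hk : 2 ≤ k) (ht : 1 ≤ t) (htr : t ≤ r) :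
    ∃ (V : Type) (_ : Fintype V) (part : V → Fin r) (E : Finset (Finset V)),
      IsRPartite r part E ∧ KWiseIntersecting k t E ∧
      coverNumber E = (r - t) / k + 1 := by
  have hmul : k * ((r - t) / k) ≤ r - t := Nat.mul_div_le _ _
  have hdiv : (r - t) / k ≤ r - t := Nat.div_le_self _ _
  exact ⟨Fin r × Fin ((r - t) / k + 1), inferInstance, Prod.fst, sparseGraphs r ((r - t) / k),
    isRPartite_sparseGraphs _ _, kWiseIntersecting_sparseGraphs (by omega),
    coverNumber_sparseGraphs (by omega)⟩
end

section
/- Let r ≥ 1 and 0 ≤ ℓ ≤ ⌊(r−1)/2⌋, and let H^r_ℓ be the hypergraph of Definition 2.1 (for any fixed enumeration S_1, …, S_m of the (r−ℓ)-element subsets of [r], where m = C(r, r−ℓ)). Then H^r_ℓ is an r-uniform r-partite (r−2ℓ)-intersecting hypergraph with cover number τ(H^r_ℓ) = ℓ + 1. -/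
/-- The edge with core `A` and label `i`: row `0` over the columns in `A`, row `i + 1` elsewhere. -/
def coreEdge {r m : ℕ} (A : Finset (Fin r)) (i : Fin m) : Finset (Fin (m + 1) × Fin r) :=
  (A.image fun j => ((0 : Fin (m + 1)), j)) ∪ ((Finset.univ \ A).image fun j => (Fin.succ i, j))

theorem mem_coreEdge {r m : ℕ} {A : Finset (Fin r)} {i : Fin m} {v : Fin (m + 1) × Fin r} :
    v ∈ coreEdge A i ↔ v.2 ∈ A ∧ v.1 = 0 ∨ v.2 ∉ A ∧ v.1 = i.succ := by
  obtain ⟨a, b⟩ := v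
  simp only [coreEdge, Finset.mem_union, Finset.mem_image, Finset.mem_sdiff, Finset.mem_univ,
    true_and, Prod.mk.injEq]
  grind

theorem card_filter_coreEdge {r m : ℕ} (A : Finset (Fin r)) (i : Fin m) (j : Fin r) :
    ((coreEdge A i).filter fun v => v.2 = j).card = 1 := by
  rw [Finset.card_eq_one]
  by_cases h : j ∈ A
  · refine ⟨(0, j), ?_⟩
    ext ⟨a, b⟩
    simp only [Finset.mem_filter, mem_coreEdge, Finset.mem_singleton, Prod.mk.injEq]
    grind
  · refine ⟨(i.succ, j), ?_⟩
    ext ⟨a, b⟩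
    simp only [Finset.mem_filter, mem_coreEdge, Finset.mem_singleton, Prod.mk.injEq]
    grind

theorem card_add_card_le_ncard_coreEdge_inter {r m : ℕ} (A B : Finset (Fin r)) (i k : Fin m) :
    A.card + B.card ≤
      ((↑(coreEdge A i) ∩ ↑(coreEdge B k) : Set (Fin (m + 1) × Fin r))).ncard + r := by
  have hunion : (A ∪ B).card ≤ r := by simpa using Finset.card_le_univ (A ∪ B)
  have hsub : (A ∩ B).image (fun j => ((0 : Fin (m + 1)), j)) ⊆ coreEdge A i ∩ coreEdge B k := by
    intro v hv
    obtain ⟨j, hj, rfl⟩ := Finset.mem_image.mp hv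
    simp_all [mem_coreEdge]
  have hcard := Finset.card_le_card hsub
  rw [Finset.card_image_of_injective _ (Prod.mk_right_injective _)] at hcard
  rw [← Finset.coe_inter, Set.ncard_coe_finset]
  have := Finset.card_union_add_card_inter A B
  omega

/-- A set meeting every edge whose core has `r - ℓ` elements has more than `ℓ` elements. -/
theorem succ_le_card_of_forall_meets_coreEdge {r ℓ m : ℕ} (hℓ : ℓ < r)
    {S : Fin m → Finset (Fin r)}
    (hS : ∀ A : Finset (Fin r), A.card = r - ℓ → ∃ i, S i = A)
    {C : Finset (Fin (m + 1) × Fin r)}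
    (hC : ∀ i, ∃ v ∈ coreEdge (S i) i, v ∈ C) : ℓ + 1 ≤ C.card := by
  set Z : Finset (Fin r) := Finset.univ.filter fun j => (0, j) ∈ C with hZ
  rcases le_total (ℓ + 1) Z.card with h | h
  · have hsub : Z.image (fun j => ((0 : Fin (m + 1)), j)) ⊆ C := by
      intro v hv
      obtain ⟨j, hj, rfl⟩ := Finset.mem_image.mp hv
      simpa [hZ] using hj
    have hcard := Finset.card_le_card hsub
    rw [Finset.card_image_of_injective _ (Prod.mk_right_injective _)] at hcard
    omega
  obtain ⟨T, hZT, hT⟩ := Finset.exists_superset_card_eq h (by simpa using hℓ)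
  have key : ∀ t ∈ T, ∃ v ∈ C,
      v = (0, t) ∨ ∃ i, S i = (T.erase t)ᶜ ∧ v.1 = i.succ := by
    intro t ht
    by_cases htZ : t ∈ Z
    · exact ⟨(0, t), by simpa [hZ] using htZ, Or.inl rfl⟩
    obtain ⟨i, hi⟩ := hS (T.erase t)ᶜ (by
      rw [Finset.card_compl, Finset.card_erase_of_mem ht, hT, Fintype.card_fin,
        Nat.add_sub_cancel])
    obtain ⟨⟨a, b⟩, hv, hvC⟩ := hC i
    refine ⟨(a, b), hvC, Or.inr ⟨i, hi, ?_⟩⟩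
    rcases mem_coreEdge.mp hv with ⟨hb, rfl⟩ | ⟨-, ha⟩
    · have hbZ : b ∈ Z := by simpa [hZ] using hvC
      have hbT : b ∈ T.erase t :=
        Finset.mem_erase.mpr ⟨fun hbt => htZ (hbt ▸ hbZ), hZT hbZ⟩
      rw [hi] at hb
      exact absurd hbT (Finset.mem_compl.mp hb)
    · exact ha
  choose! φ hφC hφ using key
  rw [← hT]
  refine Finset.card_le_card_of_injOn φ hφC fun s hs t ht hst => ?_
  rcases hφ s hs with h₁ | ⟨i, hi, h₁⟩ <;> rcases hφ t ht with h₂ | ⟨k, hk, h₂⟩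
  · simpa [h₁, h₂] using hst
  · rw [← hst, h₁] at h₂
    exact absurd h₂.symm (Fin.succ_ne_zero k)
  · rw [hst, h₂] at h₁
    exact absurd h₁.symm (Fin.succ_ne_zero i)
  · rw [hst, h₂] at h₁
    obtain rfl := Fin.succ_injective _ h₁
    exact (Finset.erase_inj T hs).mp (compl_injective (hi.symm.trans hk))

theorem exists_card_eq_forall_meets_coreEdge {r ℓ m : ℕ} (hℓ : ℓ < r)
    {S : Fin m → Finset (Fin r)} (hS : ∀ i, (S i).card = r - ℓ) :
    ∃ C : Finset (Fin (m + 1) × Fin r),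
      (∀ i, ∃ v ∈ coreEdge (S i) i, v ∈ C) ∧ C.card = ℓ + 1 := by
  obtain ⟨T, hT⟩ : ∃ T : Finset (Fin r), T.card = ℓ + 1 := by
    obtain ⟨T, -, hT⟩ := Finset.exists_subset_card_eq
      (s := (Finset.univ : Finset (Fin r))) (n := ℓ + 1) (by simpa using hℓ)
    exact ⟨T, hT⟩
  refine ⟨T.image fun j => (0, j), fun i => ?_, ?_⟩
  · have hmeet : (S i ∩ T).Nonempty := by
      rw [← Finset.card_pos]
      have hunion : (S i ∪ T).card ≤ r := by simpa using Finset.card_le_univ (S i ∪ T)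
      have := Finset.card_union_add_card_inter (S i) T
      have := hS i
      omega
    obtain ⟨j, hj⟩ := hmeet
    rw [Finset.mem_inter] at hj
    exact ⟨(0, j), mem_coreEdge.mpr (Or.inl ⟨hj.1, rfl⟩), Finset.mem_image_of_mem _ hj.2⟩
  · rw [Finset.card_image_of_injective _ (Prod.mk_right_injective _), hT]

/-- **Proposition 2.2**: for `1 ≤ r` and `0 ≤ ℓ ≤ ⌊(r-1)/2⌋`, the hypergraph `H^r_ℓ`
of Definition 2.1 (built from any enumeration `S` of the `(r-ℓ)`-element subsets of
`Fin r`, with `m = C(r, r-ℓ)`, vertex set `Fin (m+1) × Fin r` and edges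
`e_i = {(0,j) : j ∈ S i} ∪ {(i+1,j) : j ∉ S i}`) is an `r`-uniform `r`-partite
`(r - 2ℓ)`-intersecting hypergraph with cover number `ℓ + 1`. -/
theorem construction_is_intersecting_and_cover_eq (r ℓ : ℕ) (hr : 1 ≤ r)
    (hℓ : ℓ ≤ (r - 1) / 2)
    (m : ℕ) (hm : m = Nat.choose r (r - ℓ))
    (S : Fin m → Finset (Fin r))
    (hScard : ∀ i, (S i).card = r - ℓ)
    (hSinj : Function.Injective S)
    (hSsurj : ∀ A : Finset (Fin r), A.card = r - ℓ → ∃ i, S i = A)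
    (E : Finset (Finset (Fin (m + 1) × Fin r)))
    (hE : E = Finset.univ.image (fun i : Fin m =>
      ((S i).image fun j => ((0 : Fin (m + 1)), j)) ∪
      ((Finset.univ \ S i).image fun j => (Fin.succ i, j)))) :
    IsRPartite r (fun v => v.2) E ∧ IntersectingGe (r - 2 * ℓ) E ∧
    coverNumber E = ℓ + 1 := by
  have hlt : ℓ < r := by omega
  replace hE : E = Finset.univ.image fun i : Fin m => coreEdge (S i) i := hE
  subst hE
  have hcover : ∀ C, IsCover (Finset.univ.image fun i : Fin m => coreEdge (S i) i) C ↔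
      ∀ i, ∃ v ∈ coreEdge (S i) i, v ∈ C := fun C => by simp [IsCover]
  refine ⟨?_, ?_, ?_⟩
  · intro e he j
    obtain ⟨i, -, rfl⟩ := Finset.mem_image.mp he
    exact card_filter_coreEdge (S i) i j
  · intro e he f hf
    obtain ⟨i, -, rfl⟩ := Finset.mem_image.mp he
    obtain ⟨k, -, rfl⟩ := Finset.mem_image.mp hf
    have := card_add_card_le_ncard_coreEdge_inter (S i) (S k) i k
    rw [hScard, hScard] at this
    omega
  · refine IsLeast.csInf_eq ⟨?_, ?_⟩
    · obtain ⟨C, hC, hcard⟩ := exists_card_eq_forall_meets_coreEdge hlt hScard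
      exact ⟨C, (hcover C).mpr hC, hcard⟩
    · rintro n ⟨C, hC, rfl⟩
      exact succ_le_card_of_forall_meets_coreEdge hlt hSsurj ((hcover C).mp hC)
end

section
/- Let H be an (r,t)-graph with 1 ≤ t ≤ r, let e_1, e_2 be edges of H, and set t' = |e_1 ∩ e_2| (so t' ≥ t). If r − 2t + 1 ≤ t' ≤ r, then τ(H) ≤ ⌊(r−t')/2⌋ + t' − t + 1; and if t ≤ t' ≤ r − 2t, then τ(H) ≤ 2r − 4t − t' + 2. -/
theorem IntersectingGe.le_card_inter {V : Type} [DecidableEq V] {t : ℕ}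
    {E : Finset (Finset V)} (hI : IntersectingGe t E) {e f : Finset V} (he : e ∈ E)
    (hf : f ∈ E) : t ≤ (e ∩ f).card := by
  simpa only [← Finset.coe_inter, Set.ncard_coe_finset] using hI e he f hf

/-- If `C` contains every vertex of `e₁ ∪ e₂` in the parts `S`, then `C` is a cover as soon as
few parts lie outside `S` and few common vertices of `e₁` and `e₂` lie outside `C`. -/
theorem isCover_of_two_edges {V : Type} [DecidableEq V] {r t : ℕ} {part : V → Fin r}
    {E : Finset (Finset V)} (hP : IsRPartite r part E) (hI : IntersectingGe t E)
    {e₁ e₂ : Finset V} (he₁ : e₁ ∈ E) (he₂ : e₂ ∈ E) {C : Finset V} {S : Finset (Fin r)}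
    (hS : ∀ v ∈ e₁ ∪ e₂, part v ∈ S → v ∈ C)
    (hcard : Sᶜ.card + ((e₁ ∩ e₂) \ C).card < 2 * t) : IsCover E C := by
  intro f hf
  by_contra! hfC
  have h₁ := hI.le_card_inter hf he₁
  have h₂ := hI.le_card_inter hf he₂
  have hsum := Finset.card_union_add_card_inter (f ∩ e₁) (f ∩ e₂)
  have hunion : (f ∩ e₁ ∪ f ∩ e₂).card ≤ Sᶜ.card := by
    refine Finset.card_le_card_of_injOn part ?_ ?_
    · intro v hv
      have hv' : v ∈ f ∧ v ∈ e₁ ∪ e₂ := by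
        simpa [← Finset.inter_union_distrib_left] using hv
      simpa using fun h => hfC v hv'.1 (hS v hv'.2 h)
    · refine (hP.injOn hf).mono fun v hv => ?_
      have hv' : v ∈ f ∧ v ∈ e₁ ∪ e₂ := by
        simpa [← Finset.inter_union_distrib_left] using hv
      exact hv'.1
  have hinter : (f ∩ e₁ ∩ (f ∩ e₂)).card ≤ ((e₁ ∩ e₂) \ C).card := by
    refine Finset.card_le_card fun v hv => ?_
    simp only [Finset.mem_inter, Finset.mem_sdiff] at hv ⊢
    exact ⟨⟨hv.1.2, hv.2.2⟩, hfC v hv.1.1⟩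
  omega

/-- Covering by common vertices of two edges. -/
theorem coverNumber_le_of_le_card_inter {V : Type} [DecidableEq V] {r t k : ℕ}
    {part : V → Fin r} {E : Finset (Finset V)} (hP : IsRPartite r part E)
    (hI : IntersectingGe t E) {e₁ e₂ : Finset V} (he₁ : e₁ ∈ E) (he₂ : e₂ ∈ E)
    (hk : k ≤ (e₁ ∩ e₂).card) (hlt : r + (e₁ ∩ e₂).card < 2 * t + 2 * k) :
    coverNumber E ≤ k := by
  obtain ⟨J, hJ, rfl⟩ := Finset.exists_subset_card_eq hk
  have hJ₁ : J ⊆ e₁ := hJ.trans Finset.inter_subset_left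
  have hJ₂ : J ⊆ e₂ := hJ.trans Finset.inter_subset_right
  have himage : (J.image part).card = J.card :=
    Finset.card_image_of_injOn ((hP.injOn he₁).mono hJ₁)
  refine coverNumber_le_card (isCover_of_two_edges hP hI he₁ he₂ (S := J.image part) ?_ ?_)
  · intro v hv hvS
    obtain ⟨u, hu, huv⟩ := Finset.mem_image.mp hvS
    rcases Finset.mem_union.mp hv with hv | hv
    · exact hP.injOn he₁ (hJ₁ hu) hv huv ▸ hu
    · exact hP.injOn he₂ (hJ₂ hu) hv huv ▸ hu
  · have hcompl := Finset.card_compl_add_card (J.image part)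
    rw [Fintype.card_fin] at hcompl
    have hsdiff := Finset.card_sdiff_add_card_eq_card hJ
    omega

/-- Covering by all vertices of two edges in `k` parts including those where the edges agree. -/
theorem coverNumber_add_card_inter_le {V : Type} [DecidableEq V] {r t k : ℕ}
    {part : V → Fin r} {E : Finset (Finset V)} (hP : IsRPartite r part E)
    (hI : IntersectingGe t E) {e₁ e₂ : Finset V} (he₁ : e₁ ∈ E) (he₂ : e₂ ∈ E)
    (hk : (e₁ ∩ e₂).card ≤ k) (hkr : k ≤ r) (hlt : r < 2 * t + k) :
    coverNumber E + (e₁ ∩ e₂).card ≤ 2 * k := by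
  obtain ⟨S, hS, rfl⟩ := Finset.exists_superset_card_eq
    (s := (e₁ ∩ e₂).image part) (Finset.card_image_le.trans hk) (by simpa using hkr)
  have hinter : e₁ ∩ e₂ ⊆ e₁.filter (part · ∈ S) ∩ e₂.filter (part · ∈ S) := by
    intro v hv
    have hvS := hS (Finset.mem_image_of_mem part hv)
    simp_all
  have hfilter : ∀ e ∈ E, (e.filter (part · ∈ S)).card ≤ S.card := fun e he =>
    Finset.card_le_card_of_injOn part (fun v hv => by simp_all)
      ((hP.injOn he).mono (Finset.filter_subset _ _))
  have hcover : IsCover E (e₁.filter (part · ∈ S) ∪ e₂.filter (part · ∈ S)) := by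
    refine isCover_of_two_edges hP hI he₁ he₂ (S := S) (fun v hv hvS => ?_) ?_
    · simpa [hvS] using hv
    · rw [Finset.sdiff_eq_empty_iff_subset.mpr
        (hinter.trans (Finset.inter_subset_left.trans Finset.subset_union_left))]
      have hcompl := Finset.card_compl_add_card S
      rw [Fintype.card_fin] at hcompl
      rw [Finset.card_empty]
      omega
  have hle := coverNumber_le_card hcover
  have hsum := Finset.card_union_add_card_inter
    (e₁.filter (part · ∈ S)) (e₂.filter (part · ∈ S))
  have := Finset.card_le_card hinter
  have := hfilter e₁ he₁
  have := hfilter e₂ he₂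
  omega

/-- **Lemma 2.4**: let `H` be an `(r,t)`-graph, `e₁, e₂ ∈ E(H)` and `t' = |e₁ ∩ e₂|`.
If `r - 2t + 1 ≤ t' ≤ r` then `τ(H) ≤ ⌊(r - t')/2⌋ + t' - t + 1`, and if
`t ≤ t' ≤ r - 2t` then `τ(H) ≤ 2r - 4t - t' + 2`. -/
theorem two_edge_cover_bound {V : Type} [Fintype V] (r t t' : ℕ)
    (ht : 1 ≤ t) (htr : t ≤ r)
    (part : V → Fin r) (E : Finset (Finset V))
    (hP : IsRPartite r part E) (hI : IntersectingGe t E)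
    (e₁ e₂ : Finset V) (he₁ : e₁ ∈ E) (he₂ : e₂ ∈ E)
    (ht' : t' = ((↑e₁ ∩ ↑e₂ : Set V)).ncard) :
    ((r : ℤ) - 2 * t + 1 ≤ (t' : ℤ) ∧ (t' : ℤ) ≤ (r : ℤ) →
      (coverNumber E : ℤ) ≤ ((r : ℤ) - t') / 2 + t' - t + 1) ∧
    ((t : ℤ) ≤ (t' : ℤ) ∧ (t' : ℤ) ≤ (r : ℤ) - 2 * t →
      (coverNumber E : ℤ) ≤ 2 * r - 4 * t - t' + 2) := by
  classical
  rw [← Finset.coe_inter, Set.ncard_coe_finset] at ht'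
  have htt' := hI.le_card_inter he₁ he₂
  constructor
  · rintro ⟨h₁, h₂⟩
    have := coverNumber_le_of_le_card_inter (k := (r - t') / 2 + (t' - t) + 1) hP hI he₁ he₂
      (by omega) (by omega)
    omega
  · rintro ⟨-, h₂⟩
    have := coverNumber_add_card_inter_le (k := r - 2 * t + 1) hP hI he₁ he₂
      (by omega) (by omega) (by omega)
    omega
end

section
/- Let η be a natural number and let H be an (r,t)-graph with 1 ≤ t ≤ r such that τ(H) ≥ η + 1. Then every pair of edges e, f of H satisfies either |e ∩ f| ≥ 2η + 2t − r or |e ∩ f| ≤ 2r − 4t − η + 1 (inequalities of integers). -/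
/-- An edge of an `r`-partite hypergraph is the image of a section of the part map. -/
theorem IsRPartite.exists_section {V : Type} [DecidableEq V] {r : ℕ} {part : V → Fin r}
    {E : Finset (Finset V)} (hP : IsRPartite r part E) {e : Finset V} (he : e ∈ E) :
    ∃ φ : Fin r → V, (∀ j, part (φ j) = j) ∧ e = Finset.univ.image φ := by
  choose φ hφ using fun j => Finset.card_eq_one.mp (hP e he j)
  have hmem : ∀ v j, (v ∈ e ∧ part v = j) ↔ v = φ j := fun v j => by
    simpa using Finset.ext_iff.mp (hφ j) v
  refine ⟨φ, fun j => ((hmem (φ j) j).mpr rfl).2, ?_⟩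
  ext v
  simp only [Finset.mem_image, Finset.mem_univ, true_and]
  constructor
  · exact fun hv => ⟨part v, ((hmem v _).mp ⟨hv, rfl⟩).symm⟩
  · rintro ⟨j, rfl⟩
    exact ((hmem (φ j) j).mpr rfl).1

/-- The intersection of the images of two sections has as many elements as there are
indices on which the sections agree. -/
theorem ncard_inter_image_section {V : Type} [DecidableEq V] {r : ℕ} {part : V → Fin r}
    {φ ψ : Fin r → V} (hφ : ∀ j, part (φ j) = j) (hψ : ∀ j, part (ψ j) = j) :
    ((↑(Finset.univ.image φ) ∩ ↑(Finset.univ.image ψ) : Set V)).ncard =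
      (Finset.univ.filter fun j => φ j = ψ j).card := by
  have hinj : Function.Injective φ := Function.LeftInverse.injective hφ
  rw [← Finset.coe_inter, Set.ncard_coe_finset, ← Finset.card_image_of_injective _ hinj]
  congr 1
  ext v
  simp only [Finset.mem_inter, Finset.mem_image, Finset.mem_univ, true_and, Finset.mem_filter]
  constructor
  · rintro ⟨⟨i, rfl⟩, j, hj⟩
    have hij : j = i := by rw [← hψ j, hj, hφ]
    exact ⟨i, by rw [← hj, hij], rfl⟩
  · rintro ⟨i, hi, rfl⟩
    exact ⟨⟨i, rfl⟩, i, hi.symm⟩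

/-- A set with fewer vertices than the cover number misses some edge. -/
theorem exists_edge_disjoint_of_card_lt_coverNumber {V : Type} {E : Finset (Finset V)}
    {C : Finset V} (hC : C.card < coverNumber E) : ∃ g ∈ E, ∀ v ∈ g, v ∉ C := by
  by_contra! h
  exact (Nat.sInf_le ⟨C, h, rfl⟩ : coverNumber E ≤ C.card).not_gt hC

/-- If two edges meet in `s` vertices, then deleting their vertices in `a` parts where they agree
and in `b` parts where they differ leaves an edge meeting both of them elsewhere, which bounds `t`
provided that the number `a + 2 * b` of deleted vertices is below the cover number. -/
theorem two_mul_add_le_of_lt_coverNumber {V : Type} {r t : ℕ} {part : V → Fin r}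
    {E : Finset (Finset V)} (hP : IsRPartite r part E) (hI : IntersectingGe t E)
    {e f : Finset V} (he : e ∈ E) (hf : f ∈ E) {a b : ℕ}
    (ha : a ≤ ((↑e ∩ ↑f : Set V)).ncard) (hb : b + ((↑e ∩ ↑f : Set V)).ncard ≤ r)
    (hab : a + 2 * b < coverNumber E) :
    2 * t + 2 * a + b ≤ r + ((↑e ∩ ↑f : Set V)).ncard := by
  classical
  obtain ⟨φ, hφ, rfl⟩ := hP.exists_section he
  obtain ⟨ψ, hψ, rfl⟩ := hP.exists_section hf
  rw [ncard_inter_image_section hφ hψ] at ha hb ⊢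
  have hsplit := Finset.card_filter_add_card_filter_not (s := Finset.univ)
    (fun j => φ j = ψ j)
  rw [Finset.card_univ, Fintype.card_fin] at hsplit
  obtain ⟨A, hA, rfl⟩ := Finset.exists_subset_card_eq ha
  obtain ⟨B, hB, rfl⟩ := Finset.exists_subset_card_eq
    (show b ≤ (Finset.univ.filter fun j => ¬ φ j = ψ j).card by omega)
  have hcard : (A.image φ ∪ (B.image φ ∪ B.image ψ)).card < coverNumber E := by
    have h₁ := Finset.card_union_le (A.image φ) (B.image φ ∪ B.image ψ)
    have h₂ := Finset.card_union_le (B.image φ) (B.image ψ)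
    have h₃ := Finset.card_image_le (s := A) (f := φ)
    have h₄ := Finset.card_image_le (s := B) (f := φ)
    have h₅ := Finset.card_image_le (s := B) (f := ψ)
    omega
  obtain ⟨g, hg, hgC⟩ := exists_edge_disjoint_of_card_lt_coverNumber hcard
  have hφg := hI _ hg _ he
  have hψg := hI _ hg _ hf
  obtain ⟨γ, hγ, rfl⟩ := hP.exists_section hg
  rw [ncard_inter_image_section hγ hφ] at hφg
  rw [ncard_inter_image_section hγ hψ] at hψg
  have hmiss : ∀ j, (j ∈ A → φ j = ψ j ∧ γ j ≠ φ j) ∧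
      (j ∈ B → φ j ≠ ψ j ∧ γ j ≠ φ j ∧ γ j ≠ ψ j) := by
    intro j
    have hj := hgC (γ j) (Finset.mem_image_of_mem _ (Finset.mem_univ j))
    simp only [Finset.mem_union, not_or] at hj
    refine ⟨fun h => ⟨(Finset.mem_filter.mp (hA h)).2, fun h' => ?_⟩,
      fun h => ⟨(Finset.mem_filter.mp (hB h)).2, fun h' => ?_, fun h' => ?_⟩⟩
    · exact hj.1 (h' ▸ Finset.mem_image_of_mem φ h)
    · exact hj.2.1 (h' ▸ Finset.mem_image_of_mem φ h)
    · exact hj.2.2 (h' ▸ Finset.mem_image_of_mem ψ h)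
  have hsum : ∑ j, ((if γ j = φ j then 1 else 0) + (if γ j = ψ j then 1 else 0) +
      2 * (if j ∈ A then 1 else 0) + (if j ∈ B then 1 else 0)) ≤
      ∑ j : Fin r, (1 + if φ j = ψ j then 1 else 0) := by
    refine Finset.sum_le_sum fun j _ => ?_
    have hj := hmiss j
    grind
  simp only [Finset.sum_add_distrib, ← Finset.mul_sum, ← Finset.card_filter,
    Finset.filter_univ_mem, Finset.sum_const, Finset.card_univ, Fintype.card_fin,
    smul_eq_mul, mul_one] at hsum
  omega

/-- **Corollary 2.5**: let `η ∈ ℕ` and let `H` be an `(r,t)`-graph with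
`τ(H) ≥ η + 1`. Then every pair of edges `e, f` of `H` satisfies either
`|e ∩ f| ≥ 2η + 2t - r` or `|e ∩ f| ≤ 2r - 4t - η + 1`, as integers. -/
theorem two_edge_intersection_dichotomy {V : Type} [Fintype V] (r t η : ℕ)
    (ht : 1 ≤ t) (htr : t ≤ r)
    (part : V → Fin r) (E : Finset (Finset V))
    (hP : IsRPartite r part E) (hI : IntersectingGe t E)
    (hτ : η + 1 ≤ coverNumber E)
    (e f : Finset V) (he : e ∈ E) (hf : f ∈ E) :
    2 * (η : ℤ) + 2 * (t : ℤ) - (r : ℤ) ≤ (((↑e ∩ ↑f : Set V)).ncard : ℤ) ∨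
    ((((↑e ∩ ↑f : Set V)).ncard : ℤ)) ≤ 2 * (r : ℤ) - 4 * (t : ℤ) - (η : ℤ) + 1 := by
  have hle : (↑e ∩ ↑f : Set V).ncard ≤ r := by
    classical
    obtain ⟨φ, hφ, rfl⟩ := hP.exists_section he
    obtain ⟨ψ, hψ, rfl⟩ := hP.exists_section hf
    rw [ncard_inter_image_section hφ hψ]
    exact (Finset.card_filter_le _ _).trans_eq (by simp)
  have key := fun a b => two_mul_add_le_of_lt_coverNumber hP hI he hf (a := a) (b := b)
  generalize (↑e ∩ ↑f : Set V).ncard = s at hle key ⊢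
  rcases le_or_gt η s with hs | hs
  · have := key η 0 hs (by omega) (by omega)
    omega
  · have hη : η < s + 2 * (r - s) := by
      by_contra! h
      have := key s (r - s) le_rfl (by omega) (by omega)
      omega
    have := key s ((η - s) / 2) le_rfl (by omega) (by omega)
    omega
end

section
/- Let H be an (r,t)-graph with 1 ≤ t ≤ r that has at least one edge and in which every vertex lies in at least one edge. Let Δ be the maximum degree and δ the minimum degree of H. Then δ·t·τ(H) ≤ (Δ − 1)·r − t·(Δ − δ − 1) (equivalently, τ(H) ≤ ((Δ−1)/δ)·(r/t) − (Δ−δ−1)/δ). -/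
/-- The degree of a vertex `v`: the number of edges of `E` containing `v`. -/
noncomputable def degree {V : Type} (E : Finset (Finset V)) (v : V) : ℕ :=
  Set.ncard {e : Finset V | e ∈ E ∧ v ∈ e}

/-- Double counting of the incidences between a vertex set and the edges. -/
theorem sum_degree_eq_sum_card_inter {V : Type} [DecidableEq V]
    (E : Finset (Finset V)) (s : Finset V) :
    ∑ v ∈ s, degree E v = ∑ f ∈ E, (s ∩ f).card := by
  have h : ∀ v, degree E v = (E.filter (fun f => v ∈ f)).card := fun v => by
    rw [degree, ← Set.ncard_coe_finset]
    congr 1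
    ext f
    simp
  simp only [h, ← Finset.filter_mem_eq_inter]
  exact Finset.sum_card_bipartiteAbove_eq_sum_card_bipartiteBelow (fun v f => v ∈ f)

/-- Every edge of an `r`-partite `r`-uniform hypergraph has `r` vertices. -/
theorem IsRPartite.card_eq {V : Type} {r : ℕ} {part : V → Fin r} {E : Finset (Finset V)}
    (hP : IsRPartite r part E) {e : Finset V} (he : e ∈ E) : e.card = r := by
  rw [Finset.card_eq_sum_card_fiberwise (f := part) (t := Finset.univ) (by simp),
    Finset.sum_congr rfl fun j _ => hP e he j]
  simp

/-- In a `t`-intersecting `(r, t)`-graph of maximum degree at most `Δ`, counting incidences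
with a fixed edge bounds the number of edges. -/
theorem intersecting_card_edges_le {V : Type} {r t : ℕ} {part : V → Fin r}
    {E : Finset (Finset V)} (hP : IsRPartite r part E) (hI : IntersectingGe t E)
    (hE : E.Nonempty) {Δ : ℕ} (hΔ : ∀ v : V, degree E v ≤ Δ) :
    r + t * (E.card - 1) ≤ r * Δ := by
  classical
  obtain ⟨e, he⟩ := hE
  have h_others : (E.erase e).card * t ≤ ∑ f ∈ E.erase e, (e ∩ f).card := by
    refine Finset.card_nsmul_le_sum _ _ _ fun f hf => ?_
    have h := hI e he f (Finset.mem_of_mem_erase hf)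
    rwa [← Finset.coe_inter, Set.ncard_coe_finset] at h
  have h_upper : ∑ v ∈ e, degree E v ≤ e.card * Δ :=
    Finset.sum_le_card_nsmul _ _ _ fun v _ => hΔ v
  rw [sum_degree_eq_sum_card_inter, ← Finset.add_sum_erase E _ he, Finset.inter_self,
    hP.card_eq he] at h_upper
  rw [Finset.card_erase_of_mem he] at h_others
  linarith [mul_comm t (E.card - 1)]

/-- The degrees in one part add up to the number of edges. -/
theorem IsRPartite.sum_degree_part {V : Type} [Fintype V] {r : ℕ} {part : V → Fin r}
    {E : Finset (Finset V)} (hP : IsRPartite r part E) (j : Fin r) :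
    ∑ v with part v = j, degree E v = E.card := by
  classical
  rw [sum_degree_eq_sum_card_inter, Finset.card_eq_sum_ones]
  refine Finset.sum_congr rfl fun f hf => ?_
  rw [← hP f hf j]
  congr 1
  ext v
  simp [and_comm]

/-- Each part is a cover. -/
theorem IsRPartite.coverNumber_le_card_part {V : Type} [Fintype V] {r : ℕ}
    {part : V → Fin r} {E : Finset (Finset V)} (hP : IsRPartite r part E) (j : Fin r) :
    coverNumber E ≤ (Finset.univ.filter (fun v => part v = j)).card := by
  refine Nat.sInf_le ⟨_, fun f hf => ?_, rfl⟩
  obtain ⟨v, hv⟩ := Finset.card_pos.mp ((hP f hf j).symm ▸ Nat.one_pos)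
  rw [Finset.mem_filter] at hv
  exact ⟨v, hv.1, by simpa using hv.2⟩

/-- **Lemma 3.2**: let `H` be an `(r,t)`-graph with at least one edge in which every
vertex lies in at least one edge, with maximum degree `Δ` and minimum degree `δ`.
Then `δ t τ(H) ≤ (Δ - 1) r - t (Δ - δ - 1)`. -/
theorem degree_cover_bound {V : Type} [Fintype V] (r t : ℕ)
    (ht : 1 ≤ t) (htr : t ≤ r)
    (part : V → Fin r) (E : Finset (Finset V))
    (hP : IsRPartite r part E) (hI : IntersectingGe t E)
    (hE : E.Nonempty) (hvert : ∀ v : V, 1 ≤ degree E v)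
    (Δ δ : ℕ)
    (hΔub : ∀ v : V, degree E v ≤ Δ) (hΔmem : ∃ v : V, degree E v = Δ)
    (hδlb : ∀ v : V, δ ≤ degree E v) (hδmem : ∃ v : V, degree E v = δ) :
    (δ : ℤ) * (t : ℤ) * (coverNumber E : ℤ)
      ≤ ((Δ : ℤ) - 1) * (r : ℤ) - (t : ℤ) * ((Δ : ℤ) - (δ : ℤ) - 1) := by
  classical
  obtain ⟨v, hv⟩ := hΔmem
  set P := Finset.univ.filter (fun w => part w = part v) with hPdef
  have hvP : v ∈ P := by simp [hPdef]
  have h_sum : ∑ w ∈ P, degree E w = E.card := hP.sum_degree_part (part v)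
  have h_cover : coverNumber E ≤ P.card := hP.coverNumber_le_card_part (part v)
  have h_rest : (P.erase v).card * δ ≤ ∑ w ∈ P.erase v, degree E w :=
    Finset.card_nsmul_le_sum _ _ _ fun w _ => hδlb w
  rw [← Finset.add_sum_erase P _ hvP, hv] at h_sum
  have h_card : (P.erase v).card + 1 = P.card := Finset.card_erase_add_one hvP
  have h_edges := intersecting_card_edges_le hP hI hE hΔub
  have h_pos : 1 ≤ E.card := hE.card_pos
  zify [h_pos] at h_sum h_cover h_rest h_card h_edges
  have h_tau : (δ : ℤ) * coverNumber E ≤ E.card - Δ + δ := by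
    have := mul_le_mul_of_nonneg_left h_cover (Int.natCast_nonneg δ)
    rw [← h_card] at this
    linarith
  have h_scaled := mul_le_mul_of_nonneg_left h_tau (Int.natCast_nonneg t)
  linarith
end

section
/- Let d ≥ 1 and let H be a d-regular (r,t)-graph with 1 ≤ t ≤ r having at least one edge. Then d·t·τ(H) ≤ (d − 1)·r + t (equivalently, τ(H) ≤ r/t − r/(dt) + 1/d). -/
open scoped Classical in
theorem degree_eq_card_filter {V : Type} (E : Finset (Finset V)) (v : V) :
    degree E v = (E.filter (fun e => v ∈ e)).card := by
  rw [degree, ← Set.ncard_coe_finset]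
  congr 1
  ext e
  simp

/-- Each part of an `r`-partite hypergraph is a cover. -/
theorem IsRPartite.isCover_part {V : Type} [Fintype V] {r : ℕ} {part : V → Fin r}
    {E : Finset (Finset V)} (hP : IsRPartite r part E) (j : Fin r) :
    IsCover E (Finset.univ.filter (fun v => part v = j)) := by
  intro e he
  obtain ⟨v, hv⟩ := Finset.card_pos.mp (by rw [hP e he j]; exact one_pos)
  rw [Finset.mem_filter] at hv
  exact ⟨v, hv.1, by simpa using hv.2⟩

open scoped Classical in
/-- Double counting of incidences between a vertex set and the edges. -/
theorem sum_card_inter_eq_sum_degree {V : Type} (E : Finset (Finset V)) (S : Finset V) :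
    ∑ f ∈ E, (S ∩ f).card = ∑ v ∈ S, degree E v := by
  simp only [degree_eq_card_filter, ← Finset.filter_mem_eq_inter]
  exact (Finset.sum_card_bipartiteAbove_eq_sum_card_bipartiteBelow
    (s := S) (t := E) (fun v f => v ∈ f)).symm

/-- In a `d`-regular `r`-partite hypergraph, each part accounts for all edges. -/
theorem IsRPartite.card_part_mul {V : Type} [Fintype V] {r d : ℕ} {part : V → Fin r}
    {E : Finset (Finset V)} (hP : IsRPartite r part E) (hreg : ∀ v : V, degree E v = d)
    (j : Fin r) : (Finset.univ.filter (fun v => part v = j)).card * d = E.card := by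
  classical
  have h := sum_card_inter_eq_sum_degree E (Finset.univ.filter (fun v => part v = j))
  have hone : ∀ f ∈ E, (Finset.univ.filter (fun v => part v = j) ∩ f).card = 1 := by
    intro f hf
    rw [← hP f hf j]
    congr 1
    ext v
    simp [and_comm]
  rw [Finset.sum_congr rfl hone] at h
  simpa [hreg] using h.symm

/-- A `d`-regular `(r,t)`-graph containing an edge has at most `1 + (d - 1) r / t` edges. -/
theorem card_edges_bound {V : Type} {r t d : ℕ} {part : V → Fin r} {E : Finset (Finset V)}
    (hP : IsRPartite r part E) (hI : IntersectingGe t E)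
    (hE : E.Nonempty) (hreg : ∀ v : V, degree E v = d) :
    t * E.card + r ≤ d * r + t := by
  classical
  obtain ⟨e, he⟩ := hE
  have h := sum_card_inter_eq_sum_degree E e
  rw [← Finset.add_sum_erase E _ he, Finset.inter_self, hP.card_eq he] at h
  simp only [hreg, Finset.sum_const, smul_eq_mul, hP.card_eq he] at h
  have hle : (E.erase e).card * t ≤ ∑ f ∈ E.erase e, (e ∩ f).card := by
    rw [← smul_eq_mul]
    refine Finset.card_nsmul_le_sum _ _ _ fun f hf => ?_
    have := hI e he f (Finset.mem_of_mem_erase hf)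
    rwa [← Finset.coe_inter, Set.ncard_coe_finset] at this
  have hcard := Finset.card_erase_add_one he
  rw [← hcard]
  linarith

/-- **Corollary 3.4** (upper bound): if `H` is a `d`-regular `(r,t)`-graph with at
least one edge, then `d t τ(H) ≤ (d - 1) r + t`, i.e.
`τ(H) ≤ r/t - r/(dt) + 1/d`. -/
theorem regular_cover_bound {V : Type} [Fintype V] (r t d : ℕ)
    (hd : 1 ≤ d) (ht : 1 ≤ t) (htr : t ≤ r)
    (part : V → Fin r) (E : Finset (Finset V))
    (hP : IsRPartite r part E) (hI : IntersectingGe t E)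
    (hE : E.Nonempty) (hreg : ∀ v : V, degree E v = d) :
    (d : ℤ) * (t : ℤ) * (coverNumber E : ℤ) ≤ ((d : ℤ) - 1) * (r : ℤ) + (t : ℤ) := by
  have hcover := coverNumber_le_card (hP.isCover_part ⟨0, by omega⟩)
  have hpart := hP.card_part_mul hreg ⟨0, by omega⟩
  have hedges := card_edges_bound hP hI hE hreg
  have hle : d * t * coverNumber E ≤ t * E.card := by
    rw [← hpart]
    calc d * t * coverNumber E ≤ d * t * _ := Nat.mul_le_mul_left _ hcover
      _ = _ := by ring
  zify at hle hedges
  linarith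
end

section
/- Let t ≥ 1 and t < r ≤ t² + 3t − 1 be integers. If H is a strictly t-intersecting r-uniform r-partite hypergraph, then τ(H) ≤ r − t. -/
/-- The hypergraph with edge set `E` is strictly `t`-intersecting:
`|e ∩ f| = t` for all distinct edges `e, f`. -/
def StrictlyIntersecting {V : Type} (t : ℕ) (E : Finset (Finset V)) : Prop :=
  ∀ e ∈ E, ∀ f ∈ E, e ≠ f → ((↑e ∩ ↑f : Set V)).ncard = t

open Finset in
theorem coverNumber_le_of_isCover {V : Type} {E : Finset (Finset V)} {C : Finset V}
    (hC : IsCover E C) : coverNumber E ≤ #C :=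
  Nat.sInf_le ⟨C, hC, rfl⟩

namespace IsRPartite

open Finset

variable {V : Type} {r t : ℕ} {part : V → Fin r} {E : Finset (Finset V)}

theorem injOn_s15 (hP : IsRPartite r part E) {e : Finset V} (he : e ∈ E) :
    Set.InjOn part e := by
  intro u hu w hw huw
  exact card_le_one.1 (hP e he (part w)).le u (mem_filter.2 ⟨hu, huw⟩) w
    (mem_filter.2 ⟨hw, rfl⟩)

theorem card_eq_s15 (hP : IsRPartite r part E) {e : Finset V} (he : e ∈ E) : #e = r := by
  rw [card_eq_sum_card_fiberwise (f := part) (t := univ) (by intro x _; simp),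
    sum_congr rfl fun j _ => hP e he j]
  simp

variable [DecidableEq V]

/-- The edges through a fixed `t`-set `T` form a sunflower, so an edge `g` not containing `T`
meets their petals in disjoint sets of size `#(T \ g)`, lying in the parts that miss `T`. -/
theorem card_filter_superset_mul_le (hP : IsRPartite r part E)
    (hE : ∀ e ∈ E, ∀ f ∈ E, e ≠ f → #(e ∩ f) = t) {T g e : Finset V} (he : e ∈ E)
    (hTe : T ⊆ e) (hT : #T = t) (hg : g ∈ E) (hTg : ¬ T ⊆ g) :
    #{f ∈ E | T ⊆ f} * #(T \ g) ≤ r - t := by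
  have hdisj : Set.PairwiseDisjoint (↑({f ∈ E | T ⊆ f}) : Set (Finset V))
      fun f => (f ∩ g) \ T := by
    intro f hf f' hf' hne
    simp only [coe_filter, Set.mem_ofPred_eq] at hf hf'
    have hint : T = f ∩ f' := eq_of_subset_of_card_le (subset_inter hf.2 hf'.2)
      (by rw [hE f hf.1 f' hf'.1 hne, hT])
    refine Finset.disjoint_left.2 fun u hu hu' => ?_
    simp only [mem_sdiff, mem_inter] at hu hu'
    exact hu.2 (hint ▸ mem_inter.2 ⟨hu.1.1, hu'.1.1⟩)
  have hpetal : ∀ f ∈ E, T ⊆ f → #((f ∩ g) \ T) = #(T \ g) := by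
    intro f hf hTf
    have hfg := hE f hf g hg (by rintro rfl; exact hTg hTf)
    have h1 := card_sdiff_add_card_inter (f ∩ g) T
    have h2 := card_sdiff_add_card_inter T g
    have h3 : f ∩ g ∩ T = T ∩ g := by grind
    rw [h3] at h1
    lia
  have hcompl : #((T.image part)ᶜ) = r - t := by
    rw [card_compl, Fintype.card_fin,
      card_image_of_injOn ((hP.injOn_s15 he).mono (coe_subset.2 hTe)), hT]
  calc #{f ∈ E | T ⊆ f} * #(T \ g)
      = #(({f ∈ E | T ⊆ f}).biUnion fun f => (f ∩ g) \ T) := by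
        rw [card_biUnion hdisj, sum_const_nat]
        intro f hf
        rw [mem_filter] at hf
        exact hpetal f hf.1 hf.2
    _ ≤ #((T.image part)ᶜ) := by
        refine card_le_card_of_injOn part ?_ ?_
        · intro u hu
          simp only [coe_biUnion, Set.mem_iUnion, coe_filter, Set.mem_ofPred_eq, mem_coe,
            mem_sdiff, mem_inter] at hu
          obtain ⟨f, ⟨hf, hTf⟩, ⟨huf, _⟩, huT⟩ := hu
          simp only [coe_compl, Set.mem_compl_iff, mem_coe, mem_image, not_exists, not_and]
          intro w hw hwu
          exact huT (hP.injOn_s15 hf (hTf hw) huf hwu ▸ hw)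
        · refine (hP.injOn_s15 hg).mono fun u hu => ?_
          simp only [coe_biUnion, Set.mem_iUnion, mem_coe, mem_sdiff, mem_inter] at hu
          obtain ⟨f, _, ⟨_, hug⟩, _⟩ := hu
          exact hug
    _ = r - t := hcompl

theorem exists_inter_eq (hP : IsRPartite r part E)
    (hE : ∀ e ∈ E, ∀ f ∈ E, e ≠ f → #(e ∩ f) = t) (htr : t < r)
    (hcov : ∀ C, IsCover E C → r - t < #C) {e T : Finset V} (he : e ∈ E) (hTe : T ⊆ e)
    (hT : #T = t) : ∃ f ∈ E, f ≠ e ∧ e ∩ f = T := by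
  have hcard : #(e \ T) = r - t := by rw [card_sdiff_of_subset hTe, hP.card_eq_s15 he, hT]
  have hnot : ¬ IsCover E (e \ T) := fun h => by have := hcov _ h; lia
  simp only [IsCover, not_forall, not_exists, not_and] at hnot
  obtain ⟨f, hf, hfe⟩ := hnot
  have hsub : e ∩ f ⊆ T := by
    intro u hu
    rw [mem_inter] at hu
    by_contra huT
    exact hfe u hu.2 (mem_sdiff.2 ⟨hu.1, huT⟩)
  have hne : e ≠ f := by
    rintro rfl
    have := card_le_card hsub
    rw [inter_self, hP.card_eq_s15 he] at this
    lia
  exact ⟨f, hf, hne.symm, eq_of_subset_of_card_le hsub (by rw [hE e he f hf hne, hT])⟩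

theorem card_filter_superset_le (hP : IsRPartite r part E)
    (hE : ∀ e ∈ E, ∀ f ∈ E, e ≠ f → #(e ∩ f) = t) (ht : 1 ≤ t) (htr : t < r)
    (hr : r ≤ t ^ 2 + 3 * t - 1) (hcov : ∀ C, IsCover E C → r - t < #C) {e T : Finset V}
    (he : e ∈ E) (hTe : T ⊆ e) (hT : #T = t) : #{f ∈ E | T ⊆ f} ≤ t + 1 := by
  obtain ⟨f, hf, hfe, hef⟩ := hP.exists_inter_eq hE htr hcov he hTe hT
  have htwo : 2 ≤ #{f ∈ E | T ⊆ f} := by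
    rw [← card_pair hfe]
    refine card_le_card fun x hx => ?_
    rw [mem_insert, mem_singleton] at hx
    rw [mem_filter]
    rcases hx with rfl | rfl
    · exact ⟨hf, hef ▸ inter_subset_right⟩
    · exact ⟨he, hTe⟩
  obtain ⟨S, hST, hS⟩ := exists_subset_card_eq (s := T) (n := min t (r - t)) (by lia)
  have hnot : ¬ IsCover E S := fun h => by have := hcov _ h; lia
  simp only [IsCover, not_forall, not_exists, not_and] at hnot
  obtain ⟨g, hg, hgS⟩ := hnot
  have hSg : S ⊆ T \ g := fun u hu => mem_sdiff.2 ⟨hST hu, fun hug => hgS u hug hu⟩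
  have hle := card_le_card hSg
  have hTg : ¬ T ⊆ g := by
    rw [← sdiff_eq_empty_iff_subset, ← card_eq_zero]
    lia
  have hmul := hP.card_filter_superset_mul_le hE he hTe hT hg hTg
  have hmin := (Nat.mul_le_mul_left #{f ∈ E | T ⊆ f} (hS ▸ hle)).trans hmul
  rcases le_total t (r - t) with h | h
  · rw [min_eq_left h] at hmin
    by_contra! hlt
    have : (t + 2) * t ≤ r - t := (Nat.mul_le_mul_right t hlt).trans hmin
    have : (t + 2) * t = t ^ 2 + 2 * t := by ring
    lia
  · rw [min_eq_right h] at hmin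
    have := (Nat.mul_le_mul_right (r - t) htwo).trans hmin
    lia

theorem card_erase_le (hP : IsRPartite r part E)
    (hE : ∀ e ∈ E, ∀ f ∈ E, e ≠ f → #(e ∩ f) = t) (ht : 1 ≤ t) (htr : t < r)
    (hr : r ≤ t ^ 2 + 3 * t - 1) (hcov : ∀ C, IsCover E C → r - t < #C) {e : Finset V}
    (he : e ∈ E) : #(E.erase e) ≤ t * r.choose t := by
  rw [← hP.card_eq_s15 he, ← card_powersetCard]
  refine card_le_mul_card_image_of_maps_to (f := fun f => e ∩ f) ?_ t ?_
  · intro f hf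
    rw [mem_erase] at hf
    exact mem_powersetCard.2 ⟨inter_subset_left, hE e he f hf.2 hf.1.symm⟩
  · intro T hT
    rw [mem_powersetCard] at hT
    have hle := hP.card_filter_superset_le hE ht htr hr hcov he hT.1 hT.2
    have heK : e ∈ E.filter (T ⊆ ·) := mem_filter.2 ⟨he, hT.1⟩
    have herase := card_erase_of_mem heK
    refine (card_le_card (t := (E.filter (T ⊆ ·)).erase e) fun f hf => ?_).trans (by lia)
    rw [mem_filter, mem_erase] at hf
    exact mem_erase.2 ⟨hf.1.1, mem_filter.2 ⟨hf.1.2, hf.2 ▸ inter_subset_right⟩⟩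

theorem choose_lt_degree (hP : IsRPartite r part E)
    (hE : ∀ e ∈ E, ∀ f ∈ E, e ≠ f → #(e ∩ f) = t) (ht : 1 ≤ t) (htr : t < r)
    (hcov : ∀ C, IsCover E C → r - t < #C) {e : Finset V} (he : e ∈ E) {v : V}
    (hv : v ∈ e) : (r - 1).choose (t - 1) < #{f ∈ E | v ∈ f} := by
  have key : ∀ S ∈ powersetCard (t - 1) (e.erase v),
      ∃ f ∈ E, f ≠ e ∧ e ∩ f = insert v S := by
    intro S hS
    rw [mem_powersetCard] at hS
    have hvS : v ∉ S := fun h => notMem_erase v e (hS.1 h)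
    refine hP.exists_inter_eq hE htr hcov he
      (insert_subset hv (hS.1.trans (erase_subset _ _))) ?_
    rw [card_insert_of_notMem hvS, hS.2]
    lia
  choose! F hFE hFne hF using key
  have heK : e ∈ E.filter (v ∈ ·) := mem_filter.2 ⟨he, hv⟩
  rw [← hP.card_eq_s15 he, ← card_erase_of_mem hv, ← card_powersetCard]
  refine (card_le_card_of_injOn (t := (E.filter (v ∈ ·)).erase e) F ?_ ?_).trans_lt
    (card_erase_lt_of_mem heK)
  · intro S hS
    refine mem_erase.2 ⟨hFne S hS, mem_filter.2 ⟨hFE S hS, ?_⟩⟩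
    have : v ∈ e ∩ F S := hF S hS ▸ mem_insert_self v S
    exact (mem_inter.1 this).2
  · intro S hS S' hS' hSS'
    have hins : insert v S = insert v S' := by rw [← hF S hS, ← hF S' hS', hSS']
    rw [mem_coe, mem_powersetCard] at hS hS'
    rw [← erase_insert (fun h => notMem_erase v e (hS.1 h)), hins,
      erase_insert (fun h => notMem_erase v e (hS'.1 h))]

theorem sum_degree_eq (hP : IsRPartite r part E)
    (hE : ∀ e ∈ E, ∀ f ∈ E, e ≠ f → #(e ∩ f) = t) {e : Finset V} (he : e ∈ E) :
    ∑ v ∈ e, #{f ∈ E | v ∈ f} = r + t * #(E.erase e) := by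
  have hcount : ∑ v ∈ e, #{f ∈ E | v ∈ f} = ∑ f ∈ E, #(e ∩ f) := by
    simp_rw [← filter_mem_eq_inter]
    exact sum_card_bipartiteAbove_eq_sum_card_bipartiteBelow _
  rw [hcount, ← add_sum_erase E _ he, inter_self, hP.card_eq_s15 he,
    sum_const_nat fun f hf => hE e he f (mem_of_mem_erase hf) (ne_of_mem_erase hf).symm,
    mul_comm]

theorem degree_add_le (hP : IsRPartite r part E) {d : ℕ}
    (hd : ∀ e ∈ E, ∀ v ∈ e, d ≤ #{f ∈ E | v ∈ f})
    (hcov : ∀ C, IsCover E C → r - t < #C) {e : Finset V} (he : e ∈ E) {v : V}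
    (hv : v ∈ e) : #{f ∈ E | v ∈ f} + (r - t) * d ≤ #E := by
  set U : Finset V := {u ∈ E.biUnion id | part u = part v} with hU
  have hUcov : IsCover E U := by
    intro f hf
    obtain ⟨u, hu⟩ := card_pos.1 ((hP f hf (part v)).symm ▸ Nat.one_pos)
    rw [mem_filter] at hu
    exact ⟨u, hu.1, mem_filter.2 ⟨mem_biUnion.2 ⟨f, hf, hu.1⟩, hu.2⟩⟩
  have hvU : v ∈ U := mem_filter.2 ⟨mem_biUnion.2 ⟨e, he, hv⟩, rfl⟩
  have hcard : r - t ≤ #(U.erase v) := by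
    have := hcov U hUcov
    rw [card_erase_of_mem hvU]
    lia
  have hcount : ∑ u ∈ U, #{f ∈ E | u ∈ f} = #E := by
    rw [card_eq_sum_ones]
    refine (sum_card_bipartiteAbove_eq_sum_card_bipartiteBelow _).trans
      (sum_congr rfl fun f hf => ?_)
    rw [← hP f hf (part v)]
    congr 1
    ext u
    simp only [bipartiteBelow, hU, mem_filter, mem_biUnion, id]
    exact ⟨fun h => ⟨h.2, h.1.2⟩, fun h => ⟨⟨⟨f, hf, h.1⟩, h.2⟩, h.1⟩⟩
  rw [← hcount, ← add_sum_erase U _ hvU]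
  refine Nat.add_le_add_left ((Nat.mul_le_mul_right d hcard).trans ?_) _
  rw [← smul_eq_mul]
  refine card_nsmul_le_sum _ _ _ fun u hu => ?_
  obtain ⟨f, hf, huf⟩ := mem_biUnion.1 (mem_filter.1 (mem_of_mem_erase hu)).1
  exact hd f hf u huf

end IsRPartite

/-- **Theorem 3.5**: let `t ≥ 1` and `t < r ≤ t² + 3t - 1`. If `H` is a strictly
`t`-intersecting `r`-uniform `r`-partite hypergraph, then `τ(H) ≤ r - t`. -/
theorem strictly_intersecting_cover_bound {V : Type} [Fintype V] (r t : ℕ)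
    (ht : 1 ≤ t) (htr : t < r) (hr : r ≤ t ^ 2 + 3 * t - 1)
    (part : V → Fin r) (E : Finset (Finset V))
    (hP : IsRPartite r part E) (hS : StrictlyIntersecting t E) :
    coverNumber E ≤ r - t := by
  classical
  by_contra! hlt
  have hcov : ∀ C, IsCover E C → r - t < C.card := fun C hC =>
    hlt.trans_le (coverNumber_le_of_isCover hC)
  have hE : ∀ e ∈ E, ∀ f ∈ E, e ≠ f → (e ∩ f).card = t := by
    intro e he f hf hne
    rw [← hS e he f hf hne, ← Finset.coe_inter, Set.ncard_coe_finset]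
  obtain ⟨e, he⟩ : E.Nonempty := by
    rw [Finset.nonempty_iff_ne_empty]
    rintro rfl
    simpa using hcov ∅ (by simp [IsCover])
  have hupper := hP.card_erase_le hE ht htr hr hcov he
  have hlower := Finset.sum_le_sum fun v hv =>
    hP.degree_add_le (t := t) (fun f hf u hu => hP.choose_lt_degree hE ht htr hcov hf hu)
      hcov he (v := v) hv
  rw [Finset.sum_add_distrib, hP.sum_degree_eq hE he, Finset.sum_const, Finset.sum_const,
    hP.card_eq_s15 he, smul_eq_mul, smul_eq_mul, ← Finset.card_erase_add_one he] at hlower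
  have hchoose : r * (r - 1).choose (t - 1) = t * r.choose t := by
    have := Nat.add_one_mul_choose_eq (r - 1) (t - 1)
    rw [Nat.sub_add_cancel (ht.trans htr.le), Nat.sub_add_cancel ht] at this
    rw [this, mul_comm]
  obtain ⟨k, rfl⟩ := Nat.exists_eq_add_of_lt htr
  set m := (E.erase e).card
  have hk : t + k + 1 - t = k + 1 := by lia
  rw [hk, Nat.succ_eq_add_one] at hlower
  have : (k + 1) * (t * (t + k + 1).choose t + (t + k + 1)) ≤ (k + 1) * m := by
    rw [← hchoose]
    nlinarith
  have := Nat.le_of_mul_le_mul_left this k.succ_pos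
  lia
end
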